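/- arXiv:1311.1786 — 7 statements merged into one kernel-verified Lean document; each statement's English description precedes it below -/
import Mathlib

section
/- Let p be a prime and G a finite group with normal subgroups K₁ and K₂ such that K₁ ∩ K₂ ≤ O_{p'}(G). For any finite group X write X̄ := X/O_{p'}(X). Suppose that (G/K₁)‾ is isomorphic to a direct product ∏_{i ∈ I} M_i and (G/K₂)‾ is isomorphic to a direct product ∏_{j ∈ J} N_j, where I, J are finite index sets and each M_i and N_j is a nonabelian simple group. Then there exist subsets I' ⊆ I and J' ⊆ J such that Ḡ = G/O_{p'}(G) is isomorphic to ∏_{i ∈ I'} M_i × ∏_{j ∈ J'} N_j. -/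
/-- Extending a surjection `φ : G →* A` by finitely many surjections onto simple groups: after
discarding redundant factors the joint map is surjective, and its kernel is unchanged. -/
theorem exists_finset_jointly_surjective {G A J : Type*} [Group G] [Group A] {N : J → Type*}
    [∀ j, Group (N j)] [∀ j, IsSimpleGroup (N j)] (φ : G →* A) (hφ : Function.Surjective φ)
    (f : ∀ j, G →* N j) (hf : ∀ j, Function.Surjective (f j)) (T : Finset J) :
    ∃ T' : Finset J,
      (∀ (a : A) (x : ∀ j, N j), ∃ g, φ g = a ∧ ∀ j ∈ T', f j g = x j) ∧
      ∀ g, (φ g = 1 ∧ ∀ j ∈ T', f j g = 1) ↔ (φ g = 1 ∧ ∀ j ∈ T, f j g = 1) := by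
  classical
  induction T using Finset.induction_on with
  | empty =>
    refine ⟨∅, fun a _ => ?_, fun g => Iff.rfl⟩
    obtain ⟨g, hg⟩ := hφ a
    exact ⟨g, hg, by simp⟩
  | insert t T _ ih =>
    obtain ⟨T', hsurj, hker⟩ := ih
    let D : Subgroup G := φ.ker ⊓ ⨅ j ∈ T', (f j).ker
    have hD : ∀ g, g ∈ D ↔ (φ g = 1 ∧ ∀ j ∈ T', f j g = 1) := fun g => by
      simp [D, Subgroup.mem_inf, Subgroup.mem_iInf, MonoidHom.mem_ker]
    have hDn : D.Normal := by
      refine ⟨fun d hd g => (hD _).2 ?_⟩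
      obtain ⟨h₁, h₂⟩ := (hD d).1 hd
      exact ⟨by simp [h₁], fun j hj => by simp [h₂ j hj]⟩
    rcases (hDn.map (f t) (hf t)).eq_bot_or_eq_top with hbot | htop
    · refine ⟨T', hsurj, fun g => ?_⟩
      rw [Finset.forall_mem_insert, hker g]
      refine ⟨fun h => ⟨h.1, ?_, h.2⟩, fun h => ⟨h.1, h.2.2⟩⟩
      rw [← Subgroup.mem_bot, ← hbot]
      exact Subgroup.mem_map_of_mem _ ((hD g).2 ((hker g).2 h))
    · refine ⟨insert t T', fun a x => ?_, fun g => ?_⟩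
      · obtain ⟨g, hg, hgT⟩ := hsurj a x
        obtain ⟨d, hd, hdt⟩ : (f t g)⁻¹ * x t ∈ D.map (f t) := htop ▸ Subgroup.mem_top _
        obtain ⟨h₁, h₂⟩ := (hD d).1 hd
        refine ⟨g * d, by simp [hg, h₁], ?_⟩
        rw [Finset.forall_mem_insert]
        exact ⟨by simp [hdt], fun j hj => by simp [hgT j hj, h₂ j hj]⟩
      · rw [Finset.forall_mem_insert, Finset.forall_mem_insert]
        have := hker g
        tauto

/-- An element with trivial `p`-th power lying in a subgroup of order coprime to `p` is trivial. -/
theorem eq_one_of_mem_of_pow_eq_one_of_coprime {G : Type*} [Group G] {H : Subgroup G} {p : ℕ}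
    (hH : Nat.Coprime (Nat.card H) p) {x : G} (hx : x ∈ H) (hxp : x ^ p = 1) : x = 1 :=
  orderOf_eq_one_iff.1 <| Nat.dvd_one.1 <| hH ▸
    Nat.dvd_gcd (Subgroup.orderOf_dvd_natCard H hx) (orderOf_dvd_of_pow_eq_one hxp)

/-- If `K₁ ⊓ K₂` lies in `O_{p'}(G)`, then `O_{p'}(G)` is the intersection of the preimages of
`O_{p'}(G ⧸ K₁)` and `O_{p'}(G ⧸ K₂)`. -/
theorem mem_pPrimeCore_iff_of_inf_le {p : ℕ} (hp : p.Prime) {G : Type*} [Group G] [Finite G]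
    {K₁ K₂ : Subgroup G} [K₁.Normal] [K₂.Normal] {OG : Subgroup G} [OG.Normal]
    (hOG : Nat.Coprime (Nat.card OG) p)
    (hOGmax : ∀ N : Subgroup G, N.Normal → Nat.Coprime (Nat.card N) p → N ≤ OG)
    (hK : K₁ ⊓ K₂ ≤ OG)
    {O₁ : Subgroup (G ⧸ K₁)} [O₁.Normal] (hO₁ : Nat.Coprime (Nat.card O₁) p)
    (hO₁max : ∀ N : Subgroup (G ⧸ K₁), N.Normal → Nat.Coprime (Nat.card N) p → N ≤ O₁)
    {O₂ : Subgroup (G ⧸ K₂)} [O₂.Normal] (hO₂ : Nat.Coprime (Nat.card O₂) p)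
    (hO₂max : ∀ N : Subgroup (G ⧸ K₂), N.Normal → Nat.Coprime (Nat.card N) p → N ≤ O₂)
    (g : G) : g ∈ OG ↔ (g : G ⧸ K₁) ∈ O₁ ∧ (g : G ⧸ K₂) ∈ O₂ := by
  have image_mem {K : Subgroup G} [K.Normal] {O : Subgroup (G ⧸ K)}
      (hmax : ∀ N : Subgroup (G ⧸ K), N.Normal → Nat.Coprime (Nat.card N) p → N ≤ O)
      (hg : g ∈ OG) : (g : G ⧸ K) ∈ O :=
    hmax (OG.map (QuotientGroup.mk' K))
      (Subgroup.Normal.map inferInstance _ (QuotientGroup.mk'_surjective K))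
      (hOG.coprime_dvd_left (Subgroup.card_map_dvd _ _)) (Subgroup.mem_map_of_mem _ hg)
  refine ⟨fun hg => ⟨image_mem hO₁max hg, image_mem hO₂max hg⟩, fun hg => ?_⟩
  let D : Subgroup G := O₁.comap (QuotientGroup.mk' K₁) ⊓ O₂.comap (QuotientGroup.mk' K₂)
  refine hOGmax D inferInstance ?_ (show g ∈ D from hg)
  rw [Nat.coprime_comm, hp.coprime_iff_not_dvd]
  intro hdvd
  have : Fact p.Prime := ⟨hp⟩
  obtain ⟨⟨x, hxD⟩, hx⟩ := exists_prime_orderOf_dvd_card' p hdvd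
  rw [Subgroup.orderOf_mk] at hx
  obtain ⟨hx₁, hx₂⟩ := hxD
  have hxp : x ^ p = 1 := hx ▸ pow_orderOf_eq_one x
  have hxK₁ : x ∈ K₁ := (QuotientGroup.eq_one_iff x).1 <|
    eq_one_of_mem_of_pow_eq_one_of_coprime hO₁ hx₁ (congrArg (QuotientGroup.mk' K₁) hxp)
  have hxK₂ : x ∈ K₂ := (QuotientGroup.eq_one_iff x).1 <|
    eq_one_of_mem_of_pow_eq_one_of_coprime hO₂ hx₂ (congrArg (QuotientGroup.mk' K₂) hxp)
  have hx1 := eq_one_of_mem_of_pow_eq_one_of_coprime hOG (hK ⟨hxK₁, hxK₂⟩) hxp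
  rw [hx1, orderOf_one] at hx
  exact hp.one_lt.ne hx

/-- Let `p` be a prime and `G` a finite group with normal subgroups
`K₁`, `K₂` such that `K₁ ∩ K₂ ≤ O_{p'}(G)`.  If `(G/K₁)/O_{p'}(G/K₁) ≅ ∏_{i ∈ I} M_i` and
`(G/K₂)/O_{p'}(G/K₂) ≅ ∏_{j ∈ J} N_j` with all `M_i`, `N_j` nonabelian simple, then there
are subsets `I' ⊆ I`, `J' ⊆ J` with
`G/O_{p'}(G) ≅ (∏_{i ∈ I'} M_i) × (∏_{j ∈ J'} N_j)`.
Here `O_{p'}(-)` denotes the largest normal subgroup of order coprime to `p`, encoded by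
its defining property. -/
theorem statement_3 {p : ℕ} (hp : p.Prime) {G : Type} [Group G] [Finite G]
    (K₁ K₂ : Subgroup G) [K₁.Normal] [K₂.Normal]
    -- `OG = O_{p'}(G)`:
    (OG : Subgroup G) [OG.Normal] (hOG : Nat.Coprime (Nat.card OG) p)
    (hOGmax : ∀ N : Subgroup G, N.Normal → Nat.Coprime (Nat.card N) p → N ≤ OG)
    (hK : K₁ ⊓ K₂ ≤ OG)
    -- `O₁ = O_{p'}(G/K₁)` and `O₂ = O_{p'}(G/K₂)`:
    (O₁ : Subgroup (G ⧸ K₁)) [O₁.Normal] (hO₁ : Nat.Coprime (Nat.card O₁) p)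
    (hO₁max : ∀ N : Subgroup (G ⧸ K₁), N.Normal → Nat.Coprime (Nat.card N) p → N ≤ O₁)
    (O₂ : Subgroup (G ⧸ K₂)) [O₂.Normal] (hO₂ : Nat.Coprime (Nat.card O₂) p)
    (hO₂max : ∀ N : Subgroup (G ⧸ K₂), N.Normal → Nat.Coprime (Nat.card N) p → N ≤ O₂)
    -- the simple factors:
    {I J : Type} [Finite I] [Finite J]
    (M : I → Type) [∀ i, Group (M i)] (N : J → Type) [∀ j, Group (N j)]
    (hM : ∀ i, IsSimpleGroup (M i) ∧ ∃ a b : M i, a * b ≠ b * a)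
    (hN : ∀ j, IsSimpleGroup (N j) ∧ ∃ a b : N j, a * b ≠ b * a)
    (e₁ : ((G ⧸ K₁) ⧸ O₁) ≃* ∀ i, M i)
    (e₂ : ((G ⧸ K₂) ⧸ O₂) ≃* ∀ j, N j) :
    ∃ (I' : Set I) (J' : Set J),
      Nonempty ((G ⧸ OG) ≃* ((∀ i : I', M i) × (∀ j : J', N j))) := by
  classical
  have : ∀ j, IsSimpleGroup (N j) := fun j => (hN j).1
  have := Fintype.ofFinite J
  let ψ₁ : G →* ∀ i, M i :=
    e₁.toMonoidHom.comp ((QuotientGroup.mk' O₁).comp (QuotientGroup.mk' K₁))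
  let ψ₂ : G →* ∀ j, N j :=
    e₂.toMonoidHom.comp ((QuotientGroup.mk' O₂).comp (QuotientGroup.mk' K₂))
  have hψ₁ : Function.Surjective ψ₁ := e₁.surjective.comp
    ((QuotientGroup.mk'_surjective O₁).comp (QuotientGroup.mk'_surjective K₁))
  have hψ₂ : Function.Surjective ψ₂ := e₂.surjective.comp
    ((QuotientGroup.mk'_surjective O₂).comp (QuotientGroup.mk'_surjective K₂))
  have ker₁ : ∀ g, ψ₁ g = 1 ↔ (g : G ⧸ K₁) ∈ O₁ := fun g =>
    (map_eq_one_iff e₁ e₁.injective).trans (QuotientGroup.eq_one_iff _)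
  have ker₂ : ∀ g, ψ₂ g = 1 ↔ (g : G ⧸ K₂) ∈ O₂ := fun g =>
    (map_eq_one_iff e₂ e₂.injective).trans (QuotientGroup.eq_one_iff _)
  obtain ⟨T, hsurj, hker⟩ := exists_finset_jointly_surjective ψ₁ hψ₁
    (fun j => (Pi.evalMonoidHom N j).comp ψ₂)
    (fun j => (Function.surjective_eval j).comp hψ₂) Finset.univ
  let F : G →* (∀ i : (Set.univ : Set I), M i) × (∀ j : (T : Set J), N j) :=
    MonoidHom.prod (MonoidHom.mk' (fun g i => ψ₁ g i) fun a b => by ext; simp)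
      (MonoidHom.mk' (fun g j => ψ₂ g j) fun a b => by ext; simp)
  have hF : Function.Surjective F := by
    rintro ⟨a, b⟩
    obtain ⟨g, hg, hgT⟩ := hsurj (fun i => a ⟨i, trivial⟩)
      (fun j => if h : j ∈ T then b ⟨j, h⟩ else 1)
    refine ⟨g, Prod.ext (funext fun i => congrFun hg i) (funext fun j => ?_)⟩
    exact (hgT j j.2).trans (dif_pos j.2)
  have hkerF : OG = F.ker := by
    ext g
    rw [mem_pPrimeCore_iff_of_inf_le hp hOG hOGmax hK hO₁ hO₁max hO₂ hO₂max, ← ker₁, ← ker₂,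
      MonoidHom.mem_ker]
    have h := hker g
    simp only [Finset.mem_univ, true_implies, MonoidHom.comp_apply,
      Pi.evalMonoidHom_apply] at h
    rw [show ψ₂ g = 1 ↔ ∀ j, ψ₂ g j = 1 from funext_iff, ← h, Prod.ext_iff, funext_iff,
      funext_iff, funext_iff]
    exact and_congr ⟨fun h i => h i, fun h i => h ⟨i, trivial⟩⟩
      ⟨fun h j => h j j.2, fun h j hj => h ⟨j, hj⟩⟩
  exact ⟨Set.univ, T, ⟨(QuotientGroup.quotientMulEquivOfEq hkerF).trans
    (QuotientGroup.quotientKerEquivOfSurjective F hF)⟩⟩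
end

section
/- Let p be a prime and k an algebraically closed field of characteristic p. Every nontrivial finite-dimensional irreducible representation ρ: SL_2(F_p) → GL(V) over k is weakly adequate — that is, End_k(V) is spanned as a k-vector space by the elements ρ(g) with ρ(g) a semisimple endomorphism of V — except when dim_k V = p and p ≤ 3. -/
section RepDefs

variable {k G V : Type*} [Field k] [Group G] [AddCommGroup V] [Module k V]

/-- `W` is stable under the action of the subgroup `H` via `ρ`. -/
def IsInvt (ρ : Representation k G V) (H : Subgroup G) (W : Submodule k V) : Prop :=
  ∀ g ∈ H, ∀ v ∈ W, ρ g v ∈ W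

/-- `W` is an irreducible `H`-submodule. -/
def IrredOn (ρ : Representation k G V) (H : Subgroup G) (W : Submodule k V) : Prop :=
  IsInvt ρ H W ∧ W ≠ ⊥ ∧
    ∀ U : Submodule k V, U ≤ W → IsInvt ρ H U → U = ⊥ ∨ U = W

/-- Irreducibility of the representation `ρ`. -/
def Irred (ρ : Representation k G V) : Prop := IrredOn ρ ⊤ ⊤

/-- `(G, V)` is weakly adequate: `End_k(V)` is spanned as a `k`-vector space by the
operators `ρ g`, `g ∈ G`, that are semisimple endomorphisms of `V`. -/
def WeaklyAdequate (ρ : Representation k G V) : Prop :=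
  Submodule.span k {f : V →ₗ[k] V | ∃ g : G, ρ g = f ∧ Module.End.IsSemisimple (ρ g)} = ⊤

end RepDefs

section General

variable {k G V : Type*} [Field k] [Group G] [AddCommGroup V] [Module k V]

theorem Irred.eq_top_of_invariant {ρ : Representation k G V} (h : Irred ρ) {W : Submodule k V}
    (hW : ∀ g, ∀ v ∈ W, ρ g v ∈ W) (hne : W ≠ ⊥) : W = ⊤ :=
  (h.2.2 W le_top fun g _ => hW g).resolve_left hne

theorem Irred.nontrivial {ρ : Representation k G V} (h : Irred ρ) : Nontrivial V :=
  (Submodule.nontrivial_iff k).1 ⟨_, _, h.2.1⟩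

theorem isSemisimple_of_not_dvd_orderOf [Finite G] (p : ℕ) [CharP k p] (ρ : Representation k G V)
    {g : G} (hg : ¬ p ∣ orderOf g) : Module.End.IsSemisimple (ρ g) := by
  have hn : ((orderOf g : ℕ) : k) ≠ 0 := fun h => hg ((CharP.cast_eq_zero_iff k p _).1 h)
  refine Module.End.isSemisimple_of_squarefree_aeval_eq_zero
    (Polynomial.X_pow_sub_one_separable_iff.2 hn).squarefree ?_
  rw [map_sub, map_pow, Polynomial.aeval_X, map_one, ← map_pow, pow_orderOf_eq_one, map_one,
    sub_self]

/-- The orthogonal complement, for the trace form, of the `ρ g` with `g` of order prime to `p`. -/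
def regularAnnihilator (p : ℕ) (ρ : Representation k G V) : Submodule k (Module.End k V) where
  carrier := {X | ∀ g, ¬ p ∣ orderOf g → LinearMap.trace k V (X * ρ g) = 0}
  zero_mem' := fun g _ => by simp
  add_mem' := fun {X Y} hX hY g hg => by rw [add_mul, map_add, hX g hg, hY g hg, add_zero]
  smul_mem' := fun c X hX g hg => by rw [smul_mul_assoc, map_smul, hX g hg, smul_zero]

theorem conj_mem_regularAnnihilator {p : ℕ} {ρ : Representation k G V} {X : Module.End k V}
    (hX : X ∈ regularAnnihilator p ρ) (h : G) : ρ h * X * ρ h⁻¹ ∈ regularAnnihilator p ρ := by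
  intro g hg
  have hord : orderOf (h⁻¹ * g * h) = orderOf g := by
    have := orderOf_injective (MulAut.conj h⁻¹).toMonoidHom (MulAut.conj h⁻¹).injective g
    simpa using this
  have := hX (h⁻¹ * g * h) (hord ▸ hg)
  rw [map_mul ρ, map_mul ρ, ← mul_assoc, ← mul_assoc] at this
  rw [mul_assoc, mul_assoc, LinearMap.trace_mul_comm, ← this]
  simp only [mul_assoc]

variable [FiniteDimensional k V]

theorem Irred.exists_eq_smul_one [IsAlgClosed k] {ρ : Representation k G V} (h : Irred ρ)
    {X : Module.End k V} (hX : ∀ g, Commute X (ρ g)) : ∃ c : k, X = c • 1 := by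
  have := h.nontrivial
  obtain ⟨c, hc⟩ := Module.End.exists_eigenvalue X
  refine ⟨c, ?_⟩
  have htop := h.eq_top_of_invariant (W := Module.End.eigenspace X c) (fun g v hv => by
    rw [Module.End.mem_eigenspace_iff] at hv ⊢
    rw [← Module.End.mul_apply, (hX g).eq, Module.End.mul_apply, hv, map_smul]) hc
  ext v
  have hv : v ∈ Module.End.eigenspace X c := htop ▸ Submodule.mem_top
  simpa using Module.End.mem_eigenspace_iff.1 hv

/-- Burnside's theorem on matrix algebras. -/
theorem Irred.adjoin_range_eq_top [IsAlgClosed k] {ρ : Representation k G V} (h : Irred ρ) :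
    Algebra.adjoin k (Set.range ρ) = ⊤ := by
  have := h.nontrivial
  set A := Algebra.adjoin k (Set.range ρ) with hA
  have hmem : ∀ g, ρ g ∈ A := fun g => Algebra.subset_adjoin ⟨g, rfl⟩
  have : IsSimpleModule A V := by
    rw [isSimpleModule_iff]
    refine { exists_pair_ne := ⟨⊥, ⊤, bot_ne_top⟩, eq_bot_or_eq_top := fun W => ?_ }
    rcases eq_or_ne W ⊥ with hW | hW
    · exact .inl hW
    · right
      have := h.eq_top_of_invariant (W := W.restrictScalars k)
        (fun g v hv => W.smul_mem (⟨ρ g, hmem g⟩ : A) hv) (by simpa using hW)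
      simpa using this
  rw [eq_top_iff]
  intro f _
  let F : Module.End (Module.End A V) V :=
    { toFun := f
      map_add' := map_add f
      map_smul' := fun φ v => by
        obtain ⟨c, hc⟩ := h.exists_eq_smul_one (X := φ.restrictScalars k) (fun g => by
          ext v
          exact φ.map_smul (⟨ρ g, hmem g⟩ : A) v)
        have hφ : ∀ v, φ v = c • v := fun v => by simpa using LinearMap.congr_fun hc v
        simp [hφ] }
  obtain ⟨s, hs⟩ := Module.Finite.fg_top (R := k) (M := V)
  obtain ⟨r, hr⟩ := jacobson_density F s
  have : f = r := LinearMap.ext_on hs fun v hv => hr v hv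
  rw [this]
  exact r.2

theorem eq_zero_of_trace_mul_eq_zero {Y : Module.End k V}
    (hY : ∀ Z, LinearMap.trace k V (Y * Z) = 0) : Y = 0 := by
  let b := Module.finBasis k V
  apply (LinearMap.toMatrix b b).injective
  rw [map_zero, Matrix.ext_iff_trace_mul_right]
  intro M
  have := hY (Matrix.toLin b b M)
  rw [LinearMap.trace_eq_matrix_trace k b, LinearMap.toMatrix_mul] at this
  simpa using this

theorem Irred.eq_zero_of_trace_mul_eq_zero [IsAlgClosed k] {ρ : Representation k G V}
    (h : Irred ρ) {Y : Module.End k V} (hY : ∀ g, LinearMap.trace k V (Y * ρ g) = 0) : Y = 0 := by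
  apply _root_.eq_zero_of_trace_mul_eq_zero
  intro Z
  have hZ : Z ∈ Submodule.span k (Set.range ρ) := by
    have hZ' : Z ∈ Subalgebra.toSubmodule (Algebra.adjoin k (Set.range ρ)) := by
      rw [h.adjoin_range_eq_top]; trivial
    rw [Algebra.adjoin_eq_span] at hZ'
    have hcl : Submonoid.closure (Set.range ρ) = MonoidHom.mrange ρ :=
      Submonoid.closure_eq (MonoidHom.mrange ρ)
    rwa [hcl] at hZ'
  induction hZ using Submodule.span_induction with
  | mem x hx => obtain ⟨g, rfl⟩ := hx; exact hY g
  | zero => simp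
  | add x y _ _ hx hy => rw [mul_add, map_add, hx, hy, add_zero]
  | smul c x _ hx => rw [mul_smul_comm, map_smul, hx, smul_zero]

theorem weaklyAdequate_of_regularAnnihilator_eq_bot [Finite G] (p : ℕ) [CharP k p]
    {ρ : Representation k G V} (h : regularAnnihilator p ρ = ⊥) : WeaklyAdequate ρ := by
  by_contra hne
  obtain ⟨φ, hφ, hle⟩ := Submodule.exists_le_ker_of_lt_top _ (lt_top_iff_ne_top.2 hne)
  let B : Module.End k V →ₗ[k] Module.Dual k (Module.End k V) :=
    (LinearMap.mul k (Module.End k V)).compr₂ (LinearMap.trace k V)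
  have hinj : Function.Injective B := by
    rw [injective_iff_map_eq_zero]
    intro X hX
    exact eq_zero_of_trace_mul_eq_zero fun Z => LinearMap.congr_fun hX Z
  have hsurj : Function.Surjective B :=
    (LinearMap.injective_iff_surjective_of_finrank_eq_finrank
      Subspace.dual_finrank_eq.symm).1 hinj
  obtain ⟨X, rfl⟩ := hsurj φ
  have hX : X ∈ regularAnnihilator p ρ := fun g hg =>
    LinearMap.mem_ker.1 (hle (Submodule.subset_span
      ⟨g, rfl, isSemisimple_of_not_dvd_orderOf p ρ hg⟩))
  rw [h, Submodule.mem_bot] at hX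
  exact hφ (by rw [hX, map_zero])

end General

section SpecialLinear

open Matrix

variable {F : Type*} [Field F]

/-- The upper unitriangular matrix with off-diagonal entry `a`. -/
def upperSL (a : F) : SpecialLinearGroup (Fin 2) F :=
  ⟨!![1, a; 0, 1], by simp [det_fin_two]⟩

/-- The standard representative of the nontrivial Weyl group element. -/
def weylSL : SpecialLinearGroup (Fin 2) F :=
  ⟨!![0, -1; 1, 0], by simp [det_fin_two]⟩

/-- The diagonal matrix with entries `t` and `t⁻¹`. -/
def torusSL (t : Fˣ) : SpecialLinearGroup (Fin 2) F :=
  ⟨!![(t : F), 0; 0, ((t⁻¹ : Fˣ) : F)], by simp [det_fin_two]⟩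

@[simp] theorem coe_upperSL (a : F) : (upperSL a : Matrix (Fin 2) (Fin 2) F) = !![1, a; 0, 1] := rfl

@[simp] theorem coe_weylSL :
    ((weylSL : SpecialLinearGroup (Fin 2) F) : Matrix (Fin 2) (Fin 2) F) = !![0, -1; 1, 0] := rfl

@[simp] theorem coe_torusSL (t : Fˣ) :
    (torusSL t : Matrix (Fin 2) (Fin 2) F) = !![(t : F), 0; 0, ((t⁻¹ : Fˣ) : F)] := rfl

theorem upperSL_zero : upperSL (0 : F) = 1 := by
  ext i j; fin_cases i <;> fin_cases j <;> simp

theorem upperSL_mul (a b : F) : upperSL a * upperSL b = upperSL (a + b) := by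
  ext i j; fin_cases i <;> fin_cases j <;> simp [add_comm]

theorem upperSL_pow (a : F) (n : ℕ) : upperSL a ^ n = upperSL (n * a) := by
  induction n with
  | zero => simp [upperSL_zero]
  | succ n ih => rw [pow_succ, ih, upperSL_mul]; congr 1; push_cast; ring

theorem torusSL_mul (s t : Fˣ) : torusSL s * torusSL t = torusSL (s * t) := by
  ext i j; fin_cases i <;> fin_cases j <;> simp [mul_comm]

theorem torusSL_one : torusSL (1 : Fˣ) = 1 := by
  ext i j; fin_cases i <;> fin_cases j <;> simp

theorem torusSL_mul_upperSL (t : Fˣ) (a : F) :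
    torusSL t * upperSL a = upperSL (t ^ 2 * a) * torusSL t := by
  ext i j; fin_cases i <;> fin_cases j <;> simp
  field_simp

theorem torusSL_mul_weylSL (t : Fˣ) : torusSL t * weylSL = weylSL * torusSL t⁻¹ := by
  ext i j; fin_cases i <;> fin_cases j <;> simp

theorem eq_torusSL_mul_upperSL {g : SpecialLinearGroup (Fin 2) F} (hg : g 1 0 = 0) :
    ∃ t a, g = torusSL t * upperSL a := by
  have hdet := g.det_coe
  rw [det_fin_two, hg, mul_zero, sub_zero] at hdet
  have h0 : g 0 0 ≠ 0 := left_ne_zero_of_mul_eq_one hdet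
  refine ⟨Units.mk0 _ h0, (g 0 0)⁻¹ * g 0 1, ?_⟩
  ext i j
  fin_cases i <;> fin_cases j <;> simp [h0, hg]
  exact eq_inv_of_mul_eq_one_right hdet

theorem eq_upperSL_mul_weylSL_mul {g : SpecialLinearGroup (Fin 2) F} (hg : g 1 0 ≠ 0) :
    g = upperSL (g 0 0 / g 1 0) * weylSL * torusSL (Units.mk0 _ hg) *
      upperSL (g 1 1 / g 1 0) := by
  have hdet := g.det_coe
  rw [det_fin_two] at hdet
  ext i j
  fin_cases i <;> fin_cases j <;> simp [Matrix.mul_apply, Fin.sum_univ_two] <;> field_simp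
  linear_combination -hdet

theorem trace_mul_upperSL (g : SpecialLinearGroup (Fin 2) F) (s : F) :
    trace ((g * upperSL s : SpecialLinearGroup (Fin 2) F) : Matrix (Fin 2) (Fin 2) F) =
      trace (g : Matrix (Fin 2) (Fin 2) F) + s * g 1 0 := by
  simp [trace_fin_two, Matrix.mul_apply, Fin.sum_univ_two, -cons_mul]
  ring

theorem trace_upperSL_mul (g : SpecialLinearGroup (Fin 2) F) (s : F) :
    trace ((upperSL s * g : SpecialLinearGroup (Fin 2) F) : Matrix (Fin 2) (Fin 2) F) =
      trace (g : Matrix (Fin 2) (Fin 2) F) + s * g 1 0 := by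
  simp [trace_fin_two, Matrix.mul_apply, Fin.sum_univ_two, -cons_mul]
  ring

theorem mul_upperSL_one_zero (g : SpecialLinearGroup (Fin 2) F) (s : F) :
    (g * upperSL s) 1 0 = g 1 0 := by
  simp [Matrix.mul_apply, Fin.sum_univ_two]

theorem upperSL_mul_one_zero (g : SpecialLinearGroup (Fin 2) F) (s : F) :
    (upperSL s * g) 1 0 = g 1 0 := by
  simp [Matrix.mul_apply, Fin.sum_univ_two]

theorem upperSL_mul_comm_of_trace_sq_eq {g : SpecialLinearGroup (Fin 2) F} (hg : g 1 0 = 0)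
    (htr : trace (g : Matrix (Fin 2) (Fin 2) F) ^ 2 = 4) (s : F) : upperSL s * g = g * upperSL s := by
  have hdet := g.det_coe
  rw [det_fin_two, hg] at hdet
  rw [trace_fin_two] at htr
  have h : g 0 0 = g 1 1 := by
    have : (g 0 0 - g 1 1) ^ 2 = 0 := by linear_combination htr - 4 * hdet
    exact sub_eq_zero.1 (pow_eq_zero_iff two_ne_zero |>.1 this)
  ext i j
  fin_cases i <;> fin_cases j <;> simp [Matrix.mul_apply, Fin.sum_univ_two, hg]
  rw [h]; ring

theorem trace_sq_eq_four_of_commute {g : SpecialLinearGroup (Fin 2) F} {N : Matrix (Fin 2) (Fin 2) F}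
    (hcomm : (g : Matrix (Fin 2) (Fin 2) F) * N = N * (g : Matrix (Fin 2) (Fin 2) F))
    (htr : trace N = 0) (hdet : N.det = 0) (hN : N ≠ 0) :
    trace (g : Matrix (Fin 2) (Fin 2) F) ^ 2 = 4 := by
  have hg := g.det_coe
  rw [det_fin_two] at hg hdet
  rw [trace_fin_two] at htr ⊢
  have h00 := congr_fun₂ hcomm 0 0
  have h01 := congr_fun₂ hcomm 0 1
  have h10 := congr_fun₂ hcomm 1 0
  simp only [Matrix.mul_apply, Fin.sum_univ_two] at h00 h01 h10
  have h11 : N 1 1 = - N 0 0 := by linear_combination htr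
  rw [h11] at h01 hdet h10
  generalize g 0 0 = a at *
  generalize g 0 1 = b at *
  generalize g 1 0 = c at *
  generalize g 1 1 = d at *
  by_cases hf : N 0 1 = 0
  · by_cases hi : N 1 0 = 0
    · exfalso
      have he : N 0 0 = 0 := by
        rw [hf] at hdet
        exact pow_eq_zero_iff two_ne_zero |>.1 (by linear_combination -hdet : N 0 0 ^ 2 = 0)
      apply hN
      ext i j
      fin_cases i <;> fin_cases j <;> simp [*]
    · apply mul_left_cancel₀ (pow_ne_zero 2 hi)
      generalize N 0 0 = e at *
      generalize N 0 1 = f at *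
      generalize N 1 0 = i at *
      have h10' : i * (a - d) = 2 * e * c := by linear_combination -h10
      linear_combination (i * (a - d) + 2 * e * c) * h10' + 4 * i ^ 2 * hg +
        4 * c * i * h00 - 4 * c ^ 2 * hdet
  · apply mul_left_cancel₀ (pow_ne_zero 2 hf)
    generalize N 0 0 = e at *
    generalize N 0 1 = f at *
    generalize N 1 0 = i at *
    have h01' : f * (a - d) = 2 * e * b := by linear_combination h01
    linear_combination (f * (a - d) + 2 * e * b) * h01' + 4 * f ^ 2 * hg -
      4 * b * f * h00 - 4 * b ^ 2 * hdet

variable {p : ℕ} [Fact p.Prime]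

theorem not_dvd_orderOf_of_trace_sq_ne {g : SpecialLinearGroup (Fin 2) (ZMod p)}
    (htr : trace (g : Matrix (Fin 2) (Fin 2) (ZMod p)) ^ 2 ≠ 4) : ¬ p ∣ orderOf g := by
  intro hdvd
  have hp : p.Prime := Fact.out
  have hord : orderOf (g ^ (orderOf g / p)) = p :=
    orderOf_pow_orderOf_div (orderOf_pos g).ne' hdvd
  set h := g ^ (orderOf g / p) with hh
  have hcomm : Commute g h := Commute.self_pow g _
  have hne : (h : Matrix (Fin 2) (Fin 2) (ZMod p)) - 1 ≠ 0 := by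
    intro h1
    have : h = 1 := Subtype.ext (sub_eq_zero.1 h1)
    rw [this, orderOf_one] at hord
    exact hp.one_lt.ne hord
  have hpow : ((h : Matrix (Fin 2) (Fin 2) (ZMod p)) - 1) ^ p = 0 := by
    have h1 : h ^ p = 1 := orderOf_dvd_iff_pow_eq_one.1 hord.dvd
    have h2 : (h : Matrix (Fin 2) (Fin 2) (ZMod p)) ^ p = 1 := by
      simpa using congr_arg (fun x : SpecialLinearGroup (Fin 2) (ZMod p) =>
        (x : Matrix (Fin 2) (Fin 2) (ZMod p))) h1
    rw [sub_pow_char_of_commute _ (Commute.one_right _), one_pow]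
    exact sub_eq_zero.2 h2
  refine htr (trace_sq_eq_four_of_commute (N := (h : Matrix (Fin 2) (Fin 2) (ZMod p)) - 1) ?_ ?_ ?_ hne)
  · rw [mul_sub, sub_mul, mul_one, one_mul]
    congr 1
    exact congr_arg Subtype.val hcomm.eq
  · exact (isNilpotent_trace_of_isNilpotent ⟨p, hpow⟩).eq_zero
  · have := congr_arg det hpow
    rw [det_pow, det_zero] at this
    exact pow_eq_zero_iff hp.ne_zero |>.1 this

end SpecialLinear

section Unipotent

open Matrix

variable {p : ℕ} [Fact p.Prime] {k V : Type*} [Field k] [AddCommGroup V] [Module k V]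
  {ρ : Representation k (SpecialLinearGroup (Fin 2) (ZMod p)) V}

theorem two_ne_zero_zmod (hp2 : p ≠ 2) : (2 : ZMod p) ≠ 0 := by
  exact_mod_cast ZMod.prime_ne_zero p 2 hp2

/-- Along a line of matrices on which the trace varies, a functional killing the `p`-regular
elements sees at most the two points of trace `±2`. -/
theorem trace_mul_add_trace_mul_eq_zero (hp2 : p ≠ 2)
    {X : Module.End k V} (hX : X ∈ regularAnnihilator p ρ)
    {m : ZMod p → SpecialLinearGroup (Fin 2) (ZMod p)} {x c : ZMod p} (hc : c ≠ 0)
    (hx : x ^ 2 = 4) (hm : ∀ s, trace (m s : Matrix (Fin 2) (Fin 2) (ZMod p)) = x + s * c)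
    (hsum : ∑ s, LinearMap.trace k V (X * ρ (m s)) = 0) :
    LinearMap.trace k V (X * ρ (m 0)) + LinearMap.trace k V (X * ρ (m (-(2 * x / c)))) = 0 := by
  have h2 : (2 : ZMod p) ≠ 0 := two_ne_zero_zmod hp2
  have hx0 : x ≠ 0 := by
    rintro rfl
    exact mul_ne_zero h2 h2 (by linear_combination -hx)
  rwa [Finset.sum_eq_add (0 : ZMod p) (-(2 * x / c))] at hsum
  · exact (neg_ne_zero.2 (div_ne_zero (mul_ne_zero h2 hx0) hc)).symm
  · rintro s - ⟨hs0, hs1⟩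
    refine hX _ (not_dvd_orderOf_of_trace_sq_ne fun h => ?_)
    rw [hm] at h
    have : (s * c) * (s * c + 2 * x) = 0 := by linear_combination h - hx
    rcases mul_eq_zero.1 this with h' | h'
    · exact mul_ne_zero hs0 hc h'
    · exact hs1 (by rw [← neg_div, eq_div_iff hc]; linear_combination h')
  · simp
  · simp

theorem trace_mul_conj_upperSL_step (hp2 : p ≠ 2) (hE : ∑ s : ZMod p, ρ (upperSL s) = 0)
    {X : Module.End k V} (hX : X ∈ regularAnnihilator p ρ)
    {g : SpecialLinearGroup (Fin 2) (ZMod p)} {x c : ZMod p} (hc : c ≠ 0) (hg : g 1 0 = c)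
    (hx : x ^ 2 = 4) (htr : trace (g : Matrix (Fin 2) (Fin 2) (ZMod p)) = x) :
    LinearMap.trace k V (X * ρ (upperSL (2 * x / c) * (g * upperSL (-(2 * x / c))))) =
      LinearMap.trace k V (X * ρ g) := by
  have h₁ := trace_mul_add_trace_mul_eq_zero (ρ := ρ) hp2 hX (m := fun s => g * upperSL s) hc hx
    (fun s => by rw [trace_mul_upperSL, htr, hg]) (by
      simp_rw [map_mul ρ, ← mul_assoc]
      rw [← map_sum, ← Finset.mul_sum, hE, mul_zero, map_zero])
  set g' := g * upperSL (-(2 * x / c)) with hg'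
  have htr' : trace (g' : Matrix (Fin 2) (Fin 2) (ZMod p)) = -x := by
    rw [hg', trace_mul_upperSL, htr, hg]
    field_simp
    ring
  have h₂ := trace_mul_add_trace_mul_eq_zero (ρ := ρ) hp2 hX (m := fun s => upperSL s * g') hc
    (x := -x) (by rw [neg_sq, hx])
    (fun s => by rw [trace_upperSL_mul, htr', hg', mul_upperSL_one_zero, hg]) (by
      simp_rw [map_mul ρ]
      rw [← map_sum, ← Finset.mul_sum, ← Finset.sum_mul, hE, zero_mul, mul_zero, map_zero])
  simp only [upperSL_zero, mul_one, one_mul] at h₁ h₂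
  rw [mul_neg, neg_div, neg_neg] at h₂
  linear_combination h₂ - h₁

theorem trace_mul_conj_upperSL (hp2 : p ≠ 2) (hE : ∑ s : ZMod p, ρ (upperSL s) = 0)
    {X : Module.End k V} (hX : X ∈ regularAnnihilator p ρ)
    (g : SpecialLinearGroup (Fin 2) (ZMod p)) (s : ZMod p) :
    LinearMap.trace k V (X * ρ (upperSL s * g * upperSL (-s))) =
      LinearMap.trace k V (X * ρ g) := by
  have htrace : ∀ s, trace ((upperSL s * g * upperSL (-s) :
      SpecialLinearGroup (Fin 2) (ZMod p)) : Matrix (Fin 2) (Fin 2) (ZMod p)) =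
      trace (g : Matrix (Fin 2) (Fin 2) (ZMod p)) := fun s => by
    rw [trace_mul_upperSL, trace_upperSL_mul, upperSL_mul_one_zero]; ring
  by_cases hx : trace (g : Matrix (Fin 2) (Fin 2) (ZMod p)) ^ 2 = 4
  swap
  · rw [hX _ (not_dvd_orderOf_of_trace_sq_ne hx),
      hX _ (not_dvd_orderOf_of_trace_sq_ne (by rwa [htrace]))]
  by_cases hg : g 1 0 = 0
  · rw [upperSL_mul_comm_of_trace_sq_eq hg hx, mul_assoc, upperSL_mul, add_neg_cancel,
      upperSL_zero, mul_one]
  have h2 : (2 : ZMod p) ≠ 0 := two_ne_zero_zmod hp2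
  set x := trace (g : Matrix (Fin 2) (Fin 2) (ZMod p)) with hxdef
  have hx0 : x ≠ 0 := by
    intro h
    rw [h] at hx
    exact mul_ne_zero h2 h2 (by linear_combination -hx)
  set a := 2 * x / g 1 0 with ha
  have ha0 : a ≠ 0 := div_ne_zero (mul_ne_zero h2 hx0) hg
  have key : ∀ n : ℕ, LinearMap.trace k V (X * ρ (upperSL (n * a) * g * upperSL (-(n * a)))) =
      LinearMap.trace k V (X * ρ g) := by
    intro n
    induction n with
    | zero => simp [upperSL_zero]
    | succ n ih =>
      rw [← ih, ← trace_mul_conj_upperSL_step hp2 hE hX hg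
        (by rw [mul_upperSL_one_zero, upperSL_mul_one_zero]) hx (htrace (n * a)), ← ha]
      have e₁ : upperSL (((n + 1 : ℕ) : ZMod p) * a) = upperSL a * upperSL (n * a) := by
        rw [upperSL_mul]; congr 1; push_cast; ring
      have e₂ : upperSL (-(((n + 1 : ℕ) : ZMod p) * a)) =
          upperSL (-(n * a)) * upperSL (-a) := by
        rw [upperSL_mul]; congr 1; push_cast; ring
      rw [e₁, e₂]
      simp only [mul_assoc]
  have hs : (((s / a).val : ℕ) : ZMod p) * a = s := by
    rw [ZMod.natCast_zmod_val, div_mul_cancel₀ _ ha0]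
  simpa only [hs] using key (s / a).val

theorem trace_eq_finrank_of_trace_eq_two [CharP k p] [Nontrivial V]
    {g : SpecialLinearGroup (Fin 2) (ZMod p)}
    (hg : trace (g : Matrix (Fin 2) (Fin 2) (ZMod p)) = 2) :
    LinearMap.trace k V (ρ g) = LinearMap.trace k V 1 := by
  have hp : p.Prime := Fact.out
  have hsq : ((g : Matrix (Fin 2) (Fin 2) (ZMod p)) - 1) ^ 2 = 0 := by
    have hdet := g.det_coe
    rw [det_fin_two] at hdet
    rw [trace_fin_two] at hg
    have h11 : g 1 1 = 2 - g 0 0 := by linear_combination hg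
    rw [h11] at hdet
    ext i j
    fin_cases i <;> fin_cases j <;> simp [sq, Matrix.mul_apply, Fin.sum_univ_two, h11] <;>
      first | linear_combination -hdet | ring
  have hpow : g ^ p = 1 := by
    have h1 : (g : Matrix (Fin 2) (Fin 2) (ZMod p)) ^ p = 1 := by
      have h2 := pow_eq_zero_of_le hp.two_le hsq
      rw [sub_pow_char_of_commute _ (Commute.one_right _), one_pow] at h2
      exact sub_eq_zero.1 h2
    ext i j
    simpa using congr_fun₂ h1 i j
  have : CharP (Module.End k V) p :=
    charP_of_injective_algebraMap (algebraMap k (Module.End k V)).injective p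
  have hnil : IsNilpotent (ρ g - 1) := ⟨p, by
    rw [sub_pow_char_of_commute _ (Commute.one_right _), one_pow, ← map_pow, hpow, map_one,
      sub_self]⟩
  have := (LinearMap.isNilpotent_trace_of_isNilpotent hnil).eq_zero
  rwa [map_sub, sub_eq_zero] at this

variable [FiniteDimensional k V] [IsAlgClosed k] [CharP k p]

theorem commute_upperSL_of_mem_regularAnnihilator (hirr : Irred ρ)
    (hE : ∑ s : ZMod p, ρ (upperSL s) = 0) {X : Module.End k V}
    (hX : X ∈ regularAnnihilator p ρ) (s : ZMod p) : Commute X (ρ (upperSL s)) := by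
  by_cases hp2 : p = 2
  · subst hp2
    have h : ∀ s : ZMod 2, ρ (upperSL s) = 1 := by
      have h0 : ρ (upperSL (0 : ZMod 2)) = 1 := by rw [upperSL_zero, map_one]
      have h1 : ρ (upperSL (1 : ZMod 2)) = 1 := by
        have : (2 : k) = 0 := by exact_mod_cast CharP.cast_eq_zero k 2
        have hE' : (1 : Module.End k V) + ρ (upperSL (1 : ZMod 2)) = 0 := by
          rw [← h0]; exact (Fin.sum_univ_two _).symm.trans hE
        rw [eq_neg_of_add_eq_zero_right hE', neg_eq_iff_add_eq_zero, ← two_smul k, this, zero_smul]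
      intro s
      fin_cases s
      · exact h0
      · exact h1
    rw [h]
    exact Commute.one_right X
  · have hzero : ρ (upperSL (-s)) * X * ρ (upperSL s) - X = 0 := by
      apply hirr.eq_zero_of_trace_mul_eq_zero
      intro g
      rw [sub_mul, map_sub, ← trace_mul_conj_upperSL hp2 hE hX g s, sub_eq_zero, map_mul ρ,
        map_mul ρ, mul_assoc, mul_assoc, LinearMap.trace_mul_comm]
      simp only [mul_assoc]
    have hinv : ρ (upperSL s) * ρ (upperSL (-s)) = 1 := by
      rw [← map_mul, upperSL_mul, add_neg_cancel, upperSL_zero, map_one]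
    calc X * ρ (upperSL s) = ρ (upperSL s) * ρ (upperSL (-s)) * X * ρ (upperSL s) := by
          rw [hinv, one_mul]
      _ = ρ (upperSL s) * (ρ (upperSL (-s)) * X * ρ (upperSL s)) := by simp only [mul_assoc]
      _ = ρ (upperSL s) * X := by rw [sub_eq_zero.1 hzero]

theorem subgroup_eq_top_of_upperSL_mem {F : Type*} [Field F]
    {H : Subgroup (SpecialLinearGroup (Fin 2) F)} (hu : ∀ s, upperSL s ∈ H)
    (hl : ∀ s, weylSL⁻¹ * upperSL s * weylSL ∈ H) : H = ⊤ := by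
  have key : ∀ g : SpecialLinearGroup (Fin 2) F, g 1 0 ≠ 0 → g ∈ H := by
    intro g hg
    have h : g = upperSL ((g 0 0 - 1) / g 1 0) * (weylSL⁻¹ * upperSL (-(g 1 0)) * weylSL) *
        upperSL ((g 1 1 - 1) / g 1 0) := by
      have hdet := g.det_coe
      rw [det_fin_two] at hdet
      ext i j
      fin_cases i <;> fin_cases j <;>
        simp [Matrix.mul_apply, Fin.sum_univ_two, adjugate_fin_two, -cons_mul] <;>
        field_simp <;> first | linear_combination -hdet | linear_combination hdet | ring
    rw [h]
    exact H.mul_mem (H.mul_mem (hu _) (hl _)) (hu _)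
  rw [eq_top_iff]
  intro g _
  by_cases hg : g 1 0 = 0
  · have hdet := g.det_coe
    rw [det_fin_two, hg, mul_zero, sub_zero] at hdet
    have h1 : (g * weylSL : SpecialLinearGroup (Fin 2) F) 1 0 ≠ 0 := by
      have : (g * weylSL : SpecialLinearGroup (Fin 2) F) 1 0 = g 1 1 := by
        simp [Matrix.mul_apply, Fin.sum_univ_two]
      rw [this]
      exact right_ne_zero_of_mul_eq_one hdet
    have hw : weylSL ∈ H := key _ (by simp)
    exact (H.mul_mem_cancel_right hw).1 (key _ h1)
  · exact key g hg

theorem regularAnnihilator_eq_bot_of_sum_eq_zero (hirr : Irred ρ)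
    (hE : ∑ s : ZMod p, ρ (upperSL s) = 0) : regularAnnihilator p ρ = ⊥ := by
  have := hirr.nontrivial
  rw [eq_bot_iff]
  intro X hX
  have hcomm : ∀ g, Commute X (ρ g) := by
    let H : Subgroup (SpecialLinearGroup (Fin 2) (ZMod p)) :=
      { carrier := {g | Commute X (ρ g)}
        mul_mem' := fun {a b} ha hb => by
          change Commute X (ρ (a * b)); rw [map_mul]; exact Commute.mul_right ha hb
        one_mem' := by change Commute X (ρ 1); rw [map_one]; exact Commute.one_right X
        inv_mem' := fun {a} ha => by
          have h₁ : ρ a * ρ a⁻¹ = 1 := by rw [← map_mul, mul_inv_cancel, map_one]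
          have h₂ : ρ a⁻¹ * ρ a = 1 := by rw [← map_mul, inv_mul_cancel, map_one]
          exact Commute.units_inv_right (u := ⟨ρ a, ρ a⁻¹, h₁, h₂⟩) ha }
    have hH : H = ⊤ := by
      refine subgroup_eq_top_of_upperSL_mem
        (commute_upperSL_of_mem_regularAnnihilator hirr hE hX) fun s => ?_
      change Commute X (ρ _)
      have h := commute_upperSL_of_mem_regularAnnihilator hirr hE
        (conj_mem_regularAnnihilator hX weylSL) s
      have h₂ : ρ (weylSL⁻¹ : SpecialLinearGroup (Fin 2) (ZMod p)) * ρ weylSL = 1 := by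
        rw [← map_mul, inv_mul_cancel, map_one]
      have h₃ := congr_arg (fun Y => ρ weylSL⁻¹ * Y * ρ weylSL) h.eq
      simp only [mul_assoc] at h₃
      rw [h₂, mul_one, ← mul_assoc (ρ weylSL⁻¹) (ρ weylSL), h₂, one_mul] at h₃
      rw [commute_iff_eq, map_mul, map_mul]
      simpa only [mul_assoc] using h₃
    intro g
    exact (hH ▸ Subgroup.mem_top g : g ∈ H)
  obtain ⟨c, rfl⟩ := hirr.exists_eq_smul_one hcomm
  have hone : c * LinearMap.trace k V 1 = 0 := by
    have := hX 1 (by rw [orderOf_one]; exact (Fact.out : p.Prime).one_lt.ne' ∘ Nat.dvd_one.1)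
    simpa using this
  refine hirr.eq_zero_of_trace_mul_eq_zero fun g => ?_
  by_cases hg : trace (g : Matrix (Fin 2) (Fin 2) (ZMod p)) ^ 2 = 4
  swap
  · exact hX g (not_dvd_orderOf_of_trace_sq_ne hg)
  have : (trace (g : Matrix (Fin 2) (Fin 2) (ZMod p)) - 2) *
      (trace (g : Matrix (Fin 2) (Fin 2) (ZMod p)) + 2) = 0 := by linear_combination hg
  rcases mul_eq_zero.1 this with h | h
  · rw [smul_mul_assoc, one_mul, map_smul, trace_eq_finrank_of_trace_eq_two (sub_eq_zero.1 h),
      smul_eq_mul, hone]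
  · obtain ⟨ε, hε⟩ := hirr.exists_eq_smul_one (X := ρ (-1)) (fun g => by
      rw [commute_iff_eq, ← map_mul, ← map_mul, neg_one_mul, mul_neg_one])
    have hneg : trace ((-g : SpecialLinearGroup (Fin 2) (ZMod p)) :
        Matrix (Fin 2) (Fin 2) (ZMod p)) = 2 := by
      rw [SpecialLinearGroup.coe_neg, trace_neg]
      linear_combination -h
    have hg' : ρ g = ε • ρ (-g) := by
      rw [← one_mul (ρ (-g)), ← smul_mul_assoc, ← hε, ← map_mul, neg_mul_neg, one_mul]
    rw [hg', smul_mul_smul_comm, one_mul, map_smul, trace_eq_finrank_of_trace_eq_two hneg,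
      smul_eq_mul, mul_right_comm, hone, zero_mul]

end Unipotent

section CharacterSum

variable {p : ℕ} [Fact p.Prime] {k : Type*} [Field k]

theorem sum_mul_add_pow_eq_zero (hp : 5 ≤ p) (a : ZMod p) :
    ∑ r : ZMod p, r * (a + r) ^ (p / 2) = 0 := by
  have hsum : ∀ i < p - 1, ∑ r : ZMod p, r ^ i = 0 := fun i hi =>
    FiniteField.sum_pow_lt_card_sub_one (ZMod p) i (by rwa [ZMod.card])
  calc ∑ r : ZMod p, r * (a + r) ^ (p / 2)
      = ∑ r : ZMod p, (r - a) * r ^ (p / 2) :=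
        Fintype.sum_equiv (Equiv.addLeft a) _ _ fun r => by simp
    _ = ∑ r : ZMod p, r ^ (p / 2 + 1) - a * ∑ r : ZMod p, r ^ (p / 2) := by
        rw [Finset.mul_sum, ← Finset.sum_sub_distrib]
        exact Finset.sum_congr rfl fun r _ => by ring
    _ = 0 := by rw [hsum _ (by omega), hsum _ (by omega), mul_zero, sub_zero]

/-- A function on `𝔽_p` of total mass zero that is orthogonal to all the functions
`a ↦ ((x + aγ)² - 4)^((p-1)/2)` with `γ ≠ 0` and `x ≠ ±2` vanishes. -/
theorem eq_zero_of_sum_mul_quadratic_eq_zero (hp : 5 ≤ p) (φ : ZMod p →+* k) {c : ZMod p → k}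
    (hc : ∑ a, c a = 0)
    (h : ∀ γ x : ZMod p, γ ≠ 0 → x ^ 2 ≠ 4 →
      ∑ a, c a * φ (((x + a * γ) ^ 2 - 4) ^ (p / 2)) = 0) (a : ZMod p) : c a = 0 := by
  have h2 : (2 : ZMod p) ≠ 0 := two_ne_zero_zmod (by omega)
  have hodd : 2 * (p / 2) = p - 1 := by
    have := (Fact.out : p.Prime).eq_two_or_odd
    omega
  have hpow : ∀ z : ZMod p, z ≠ 0 → (z ^ 2) ^ (p / 2) = 1 := fun z hz => by
    rw [← pow_mul, hodd, ZMod.pow_card_sub_one_eq_one hz]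
  have hne : ∀ r q : ZMod p, r ≠ 0 → q ≠ 0 → r ≠ q →
      ∑ a, c a * φ ((a + r) ^ (p / 2) * (a + q) ^ (p / 2)) = 0 := by
    intro r q hr hq hrq
    have hqr : q - r ≠ 0 := sub_ne_zero.2 hrq.symm
    have h4 : (4 : ZMod p) ≠ 0 := by
      have := mul_ne_zero h2 h2
      norm_num at this
      exact this
    set γ : ZMod p := 4 / (q - r) with hγ
    have hγ0 : γ ≠ 0 := div_ne_zero h4 hqr
    have hγq : γ * q = γ * r + 4 := by
      rw [← sub_eq_iff_eq_add', ← mul_sub, hγ, div_mul_cancel₀ _ hqr]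
    rw [← h γ (2 + r * γ) hγ0 fun hx =>
      mul_ne_zero (mul_ne_zero hr hγ0) (mul_ne_zero hγ0 hq) (by
        linear_combination hx + r * γ * hγq)]
    refine Finset.sum_congr rfl fun a _ => ?_
    have : (2 + r * γ + a * γ) ^ 2 - 4 = γ ^ 2 * ((a + r) * (a + q)) := by
      linear_combination -γ * (a + r) * hγq
    rw [this, mul_pow, hpow γ hγ0, one_mul, mul_pow]
  have hdiag : ∀ q : ZMod p, q ≠ 0 →
      ∑ a, c a * φ ((a + q) ^ (p / 2) * (a + q) ^ (p / 2)) = 0 := by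
    intro q hq
    have hall : ∑ r : ZMod p, φ r * ∑ a, c a * φ ((a + r) ^ (p / 2) * (a + q) ^ (p / 2)) = 0 := by
      simp_rw [Finset.mul_sum]
      rw [Finset.sum_comm]
      refine Finset.sum_eq_zero fun a _ => ?_
      have : ∑ r : ZMod p, φ r * (c a * φ ((a + r) ^ (p / 2) * (a + q) ^ (p / 2))) =
          c a * φ ((a + q) ^ (p / 2) * ∑ r : ZMod p, r * (a + r) ^ (p / 2)) := by
        rw [map_mul, map_sum, Finset.mul_sum, Finset.mul_sum]
        refine Finset.sum_congr rfl fun r _ => ?_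
        rw [map_mul, map_mul]
        ring
      rw [this, sum_mul_add_pow_eq_zero hp, mul_zero, map_zero, mul_zero]
    rw [Finset.sum_eq_single q] at hall
    · exact (mul_eq_zero.1 hall).resolve_left ((map_ne_zero φ).2 hq)
    · intro r _ hrq
      by_cases hr : r = 0
      · rw [hr, map_zero, zero_mul]
      · rw [hne r q hr hq hrq, mul_zero]
    · simp
  have hnz : ∀ q : ZMod p, q ≠ 0 → c (-q) = 0 := by
    intro q hq
    have hq' := hdiag q hq
    have hterm : ∀ a : ZMod p, c a * φ ((a + q) ^ (p / 2) * (a + q) ^ (p / 2)) =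
        c a - if a = -q then c a else 0 := by
      intro a
      split_ifs with ha
      · rw [ha, neg_add_cancel, zero_pow (by omega)]
        simp
      · rw [← mul_pow, ← sq, hpow _ fun h0 => ha (eq_neg_of_add_eq_zero_left h0), map_one,
          mul_one, sub_zero]
    simp_rw [hterm] at hq'
    rw [Finset.sum_sub_distrib, hc, Finset.sum_ite_eq' Finset.univ (-q) c] at hq'
    simpa using hq'
  by_cases ha : a = 0
  · rw [Finset.sum_eq_single 0 (fun b _ hb => by
      rw [← neg_neg b]; exact hnz _ (neg_ne_zero.2 hb)) (by simp)] at hc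
    rw [ha, hc]
  · rw [← neg_neg a]
    exact hnz _ (neg_ne_zero.2 ha)

end CharacterSum

section Steinberg

open Matrix

variable {p : ℕ} [Fact p.Prime] {k V : Type*} [Field k] [AddCommGroup V] [Module k V]

/-- The sum of the operators of the upper unitriangular subgroup. -/
def unipotentSum (ρ : Representation k (SpecialLinearGroup (Fin 2) (ZMod p)) V) : Module.End k V :=
  ∑ s : ZMod p, ρ (upperSL s)

/-- A nonzero vector fixed by the unipotent subgroup and spanning a torus-stable line. -/
structure IsHighestWeightVector (ρ : Representation k (SpecialLinearGroup (Fin 2) (ZMod p)) V)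
    (v : V) : Prop where
  ne_zero : v ≠ 0
  upper (s : ZMod p) : ρ (upperSL s) v = v
  torus (t : (ZMod p)ˣ) : ∃ c : k, ρ (torusSL t) v = c • v

variable {ρ : Representation k (SpecialLinearGroup (Fin 2) (ZMod p)) V}

theorem unipotentSum_apply (v : V) : unipotentSum ρ v = ∑ s : ZMod p, ρ (upperSL s) v := by
  rw [unipotentSum, LinearMap.sum_apply]

theorem rep_mul_apply {G : Type*} [Group G] {σ : Representation k G V} (g h : G) (v : V) :
    σ (g * h) v = σ g (σ h v) := by
  rw [map_mul, Module.End.mul_apply]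

theorem unipotentSum_upperSL (a : ZMod p) (v : V) :
    unipotentSum ρ (ρ (upperSL a) v) = unipotentSum ρ v := by
  simp_rw [unipotentSum_apply, ← rep_mul_apply, upperSL_mul]
  exact Fintype.sum_equiv (Equiv.addRight a) _ _ fun _ => rfl

theorem upperSL_unipotentSum (a : ZMod p) (v : V) :
    ρ (upperSL a) (unipotentSum ρ v) = unipotentSum ρ v := by
  simp_rw [unipotentSum_apply, map_sum, ← rep_mul_apply, upperSL_mul]
  exact Fintype.sum_equiv (Equiv.addLeft a) _ _ fun _ => rfl

theorem torusSL_unipotentSum (t : (ZMod p)ˣ) (v : V) :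
    ρ (torusSL t) (unipotentSum ρ v) = unipotentSum ρ (ρ (torusSL t) v) := by
  simp_rw [unipotentSum_apply, map_sum, ← rep_mul_apply, torusSL_mul_upperSL]
  exact Fintype.sum_equiv (Units.mulLeft (t ^ 2)) _ _ fun _ => by simp

theorem IsHighestWeightVector.unipotentSum_apply_of_ne_zero {v : V}
    (hv : IsHighestWeightVector ρ v)    {g : SpecialLinearGroup (Fin 2) (ZMod p)} (hg : g 1 0 ≠ 0) :
    unipotentSum ρ (ρ g v) = unipotentSum ρ (ρ weylSL (ρ (torusSL (Units.mk0 _ hg)) v)) := by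
  conv_lhs => rw [eq_upperSL_mul_weylSL_mul hg]
  rw [rep_mul_apply, hv.upper, rep_mul_apply, rep_mul_apply, unipotentSum_upperSL]

theorem exists_isHighestWeightVector [FiniteDimensional k V] [IsAlgClosed k]
    (hE : unipotentSum ρ ≠ 0) :
    ∃ v, IsHighestWeightVector ρ v := by
  obtain ⟨ζ, hζ⟩ := IsCyclic.exists_generator (α := (ZMod p)ˣ)
  obtain ⟨v₀, hv₀⟩ : ∃ v, unipotentSum ρ v ≠ 0 := by
    by_contra! h
    exact hE (LinearMap.ext h)
  let W : Submodule k V := LinearMap.range (unipotentSum ρ)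
  have hW : ∀ x ∈ W, ρ (torusSL ζ) x ∈ W := by
    rintro _ ⟨x, rfl⟩
    exact ⟨_, (torusSL_unipotentSum ζ x).symm⟩
  have : Nontrivial W := ⟨⟨_, v₀, rfl⟩, 0, fun h => hv₀ (congr_arg Subtype.val h)⟩
  obtain ⟨μ, hμ⟩ := Module.End.exists_eigenvalue ((ρ (torusSL ζ)).restrict hW)
  obtain ⟨⟨_, x, rfl⟩, hx⟩ := hμ.exists_hasEigenvector
  have heig : ρ (torusSL ζ) (unipotentSum ρ x) = μ • unipotentSum ρ x :=
    congr_arg Subtype.val hx.apply_eq_smul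
  refine ⟨unipotentSum ρ x, fun h => hx.2 (Subtype.ext h), fun s => upperSL_unipotentSum s x,
    fun t => ?_⟩
  obtain ⟨n, rfl⟩ := mem_powers_iff_mem_zpowers.2 (hζ t)
  refine ⟨μ ^ n, ?_⟩
  change ρ (torusSL (ζ ^ n)) _ = _
  induction n with
  | zero => simp [torusSL_one]
  | succ n ih => rw [pow_succ, ← torusSL_mul, rep_mul_apply, heig, map_smul, ih, smul_smul, pow_succ,
      mul_comm]

section CharP

variable [CharP k p]

theorem unipotentSum_eq_zero_of_fixed {v : V} (hv : ∀ s : ZMod p, ρ (upperSL s) v = v) :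
    unipotentSum ρ v = 0 := by
  rw [unipotentSum_apply]
  simp_rw [hv]
  rw [Finset.sum_const, Finset.card_univ, ZMod.card, ← Nat.cast_smul_eq_nsmul k,
    CharP.cast_eq_zero, zero_smul]

namespace IsHighestWeightVector

variable {v : V}

theorem unipotentSum_apply_of_eq_zero (hv : IsHighestWeightVector ρ v)
    {g : SpecialLinearGroup (Fin 2) (ZMod p)} (hg : g 1 0 = 0) : unipotentSum ρ (ρ g v) = 0 := by
  obtain ⟨t, a, rfl⟩ := eq_torusSL_mul_upperSL hg
  obtain ⟨c, hc⟩ := hv.torus t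
  rw [rep_mul_apply, hv.upper, hc, map_smul, unipotentSum_eq_zero_of_fixed hv.upper, smul_zero]

theorem unipotentSum_weylSL_ne_zero (hv : IsHighestWeightVector ρ v) (hirr : Irred ρ)
    (hE : unipotentSum ρ ≠ 0) : unipotentSum ρ (ρ weylSL v) ≠ 0 := by
  intro h
  have htop : Submodule.span k (Set.range fun g => ρ g v) = ⊤ := by
    refine hirr.eq_top_of_invariant (fun g x hx => ?_) fun hbot => hv.ne_zero ?_
    · refine Submodule.span_induction ?_ (by simp) (fun x y _ _ hx hy => ?_)
        (fun c x _ hx => ?_) hx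
      · rintro _ ⟨g', rfl⟩
        exact Submodule.subset_span ⟨g * g', rep_mul_apply g g' v⟩
      · rw [map_add]; exact add_mem hx hy
      · rw [map_smul]; exact Submodule.smul_mem _ _ hx
    · rw [← Submodule.mem_bot k, ← hbot]
      exact Submodule.subset_span ⟨1, by simp⟩
  refine hE (LinearMap.ext_on_range htop fun g => ?_)
  rw [LinearMap.zero_apply]
  by_cases hg : g 1 0 = 0
  · exact hv.unipotentSum_apply_of_eq_zero hg
  · obtain ⟨c, hc⟩ := hv.torus (Units.mk0 _ hg)
    rw [hv.unipotentSum_apply_of_ne_zero hg, hc, map_smul, map_smul, h, smul_zero]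

theorem unipotentSum_weylSL (hv : IsHighestWeightVector ρ v) (hirr : Irred ρ)
    (hE : unipotentSum ρ ≠ 0) : IsHighestWeightVector ρ (unipotentSum ρ (ρ weylSL v)) where
  ne_zero := hv.unipotentSum_weylSL_ne_zero hirr hE
  upper s := upperSL_unipotentSum s _
  torus t := by
    obtain ⟨c, hc⟩ := hv.torus t⁻¹
    exact ⟨c, by rw [torusSL_unipotentSum, ← rep_mul_apply, torusSL_mul_weylSL, rep_mul_apply, hc,
      map_smul, map_smul]⟩

theorem unipotentSum_weylSL_unipotentSum_weylSL (hv : IsHighestWeightVector ρ v) :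
    unipotentSum ρ (ρ weylSL (unipotentSum ρ (ρ weylSL v))) =
      unipotentSum ρ (ρ weylSL (∑ t : (ZMod p)ˣ, ρ (torusSL t) v)) := by
  have hentry : ∀ s : ZMod p, (weylSL * (upperSL s * weylSL) :
      SpecialLinearGroup (Fin 2) (ZMod p)) 1 0 = s := fun s => by
    simp [Matrix.mul_apply, Fin.sum_univ_two]
  rw [unipotentSum_apply (ρ weylSL v)]
  simp only [map_sum, ← rep_mul_apply]
  symm
  refine Finset.sum_of_injOn (fun t : (ZMod p)ˣ => (t : ZMod p)) (Units.val_injective.injOn)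
    (by simp) (fun s _ hs => ?_) fun t _ => ?_
  · refine hv.unipotentSum_apply_of_eq_zero ?_
    rw [hentry]
    by_contra h0
    exact hs ⟨Units.mk0 s h0, by simp, rfl⟩
  · have hne : (weylSL * (upperSL (t : ZMod p) * weylSL) :
        SpecialLinearGroup (Fin 2) (ZMod p)) 1 0 ≠ 0 := by rw [hentry]; exact t.ne_zero
    rw [hv.unipotentSum_apply_of_ne_zero hne, show Units.mk0 _ hne = t from Units.ext (hentry t),
      rep_mul_apply]

theorem torusSL_apply (hv : IsHighestWeightVector ρ v) (hirr : Irred ρ)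
    (hE : unipotentSum ρ ≠ 0) (t : (ZMod p)ˣ) : ρ (torusSL t) v = v := by
  obtain ⟨c, hc⟩ := hv.torus t
  set y := ∑ t : (ZMod p)ˣ, ρ (torusSL t) v with hy
  have hy0 : y ≠ 0 := by
    intro h0
    refine (hv.unipotentSum_weylSL hirr hE).unipotentSum_weylSL_ne_zero hirr hE ?_
    rw [hv.unipotentSum_weylSL_unipotentSum_weylSL, ← hy, h0, map_zero, map_zero]
  have h₁ : ρ (torusSL t) y = y := by
    rw [hy, map_sum]
    simp_rw [← rep_mul_apply, torusSL_mul]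
    exact Fintype.sum_equiv (Equiv.mulLeft t) _ _ fun _ => rfl
  have h₂ : ρ (torusSL t) y = c • y := by
    rw [hy, map_sum, Finset.smul_sum]
    refine Finset.sum_congr rfl fun s _ => ?_
    rw [← rep_mul_apply, torusSL_mul, mul_comm, ← torusSL_mul, rep_mul_apply, hc, map_smul]
  have hc1 : c = 1 := by
    have : (c - 1) • y = 0 := by rw [sub_smul, ← h₂, h₁, one_smul, sub_self]
    exact sub_eq_zero.1 ((smul_eq_zero.1 this).resolve_right hy0)
  rw [hc, hc1, one_smul]

end IsHighestWeightVector

variable [FiniteDimensional k V] [IsAlgClosed k]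

/-- If the unipotent sum acts nontrivially, there is a vector fixed by the Borel subgroup whose
image under the Weyl element is sent by the unipotent sum to its negative. -/
theorem exists_isHighestWeightVector_unipotentSum_weylSL_eq_neg (hirr : Irred ρ)
    (hE : unipotentSum ρ ≠ 0) :
    ∃ v, IsHighestWeightVector ρ v ∧ unipotentSum ρ (ρ weylSL v) = -v := by
  obtain ⟨v, hv⟩ := exists_isHighestWeightVector hE
  refine ⟨_, hv.unipotentSum_weylSL hirr hE, ?_⟩
  rw [hv.unipotentSum_weylSL_unipotentSum_weylSL]
  simp_rw [hv.torusSL_apply hirr hE]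
  rw [Finset.sum_const, Finset.card_univ, ZMod.card_units, ← Nat.cast_smul_eq_nsmul k,
    Nat.cast_sub (Fact.out : p.Prime).one_le, CharP.cast_eq_zero, Nat.cast_one, zero_sub,
    neg_one_smul, map_neg, map_neg]

end CharP

end Steinberg

section SteinbergBasis

open Matrix

variable {p : ℕ} [Fact p.Prime] {k V : Type*} [Field k] [AddCommGroup V] [Module k V]

/-- A basis indexed by the affine line on which `SL₂(𝔽_p)` acts by Möbius transformations, the
point at infinity being represented by minus the sum of the basis vectors. -/
structure IsSteinbergBasis (ρ : Representation k (SpecialLinearGroup (Fin 2) (ZMod p)) V)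
    (b : Module.Basis (ZMod p) k V) : Prop where
  apply_of_ne_zero (g : SpecialLinearGroup (Fin 2) (ZMod p)) (s : ZMod p) :
    g 1 0 * s + g 1 1 ≠ 0 → ρ g (b s) = b ((g 0 0 * s + g 0 1) / (g 1 0 * s + g 1 1))
  apply_of_eq_zero (g : SpecialLinearGroup (Fin 2) (ZMod p)) (s : ZMod p) :
    g 1 0 * s + g 1 1 = 0 → ρ g (b s) = -∑ r, b r

variable {ρ : Representation k (SpecialLinearGroup (Fin 2) (ZMod p)) V}

theorem upperSL_eq_upperSL_one_pow (s : ZMod p) : upperSL s = upperSL (1 : ZMod p) ^ s.val := by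
  rw [upperSL_pow, ZMod.natCast_zmod_val, mul_one]

theorem upperSL_one_pow_char : upperSL (1 : ZMod p) ^ p = 1 := by
  rw [upperSL_pow, CharP.cast_eq_zero, zero_mul, upperSL_zero]

section CharP

variable [CharP k p]

theorem sub_one_pow_eq_sum_pow {A : Type*} [Ring A] [Algebra k A] (u : A) :
    (u - 1) ^ (p - 1) = ∑ i ∈ Finset.range p, u ^ i := by
  have hpoly : (Polynomial.X - 1 : Polynomial k) ^ (p - 1) =
      ∑ i ∈ Finset.range p, Polynomial.X ^ i := by
    have hne : (Polynomial.X - 1 : Polynomial k) ≠ 0 := by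
      simpa using Polynomial.X_sub_C_ne_zero (1 : k)
    refine mul_left_cancel₀ hne ?_
    rw [mul_geom_sum, ← pow_succ', Nat.sub_add_cancel (Fact.out : p.Prime).one_le,
      sub_pow_char, one_pow]
  simpa using congr_arg (Polynomial.aeval u) hpoly

theorem unipotentSum_eq_sub_one_pow :
    unipotentSum ρ = (ρ (upperSL 1) - 1) ^ (p - 1) := by
  rw [sub_one_pow_eq_sum_pow (p := p) (k := k), unipotentSum]
  symm
  refine Finset.sum_of_injOn (fun i : ℕ => (i : ZMod p)) ?_ (by simp) (fun s _ hs => ?_)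
    fun i _ => ?_
  · intro i hi j hj hij
    simp only [Finset.coe_range, Set.mem_Iio] at hi hj
    have := congr_arg ZMod.val hij
    simpa [ZMod.val_natCast_of_lt hi, ZMod.val_natCast_of_lt hj] using this
  · exact absurd ⟨s.val, by simpa using s.val_lt, ZMod.natCast_zmod_val s⟩ hs
  · rw [← map_pow, upperSL_pow, mul_one]

theorem le_finrank_of_unipotentSum_ne_zero [FiniteDimensional k V] [Nontrivial V]
    (hE : unipotentSum ρ ≠ 0) : p ≤ Module.finrank k V := by
  by_contra! hlt
  have : CharP (Module.End k V) p :=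
    charP_of_injective_algebraMap (algebraMap k (Module.End k V)).injective p
  have hnil : IsNilpotent (ρ (upperSL 1) - 1) := ⟨p, by
    rw [sub_pow_char_of_commute _ (Commute.one_right _), one_pow, ← map_pow,
      upperSL_one_pow_char, map_one, sub_self]⟩
  have hzero : (ρ (upperSL 1) - 1) ^ Module.finrank k V = 0 := by
    have := (ρ (upperSL 1) - 1).aeval_self_charpoly
    rwa [hnil.charpoly_eq_X_pow_finrank, map_pow, Polynomial.aeval_X] at this
  exact hE (by rw [unipotentSum_eq_sub_one_pow]; exact pow_eq_zero_of_le (by omega) hzero)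

theorem exists_isSteinbergBasis [FiniteDimensional k V] [IsAlgClosed k] (hirr : Irred ρ)
    (hE : unipotentSum ρ ≠ 0) : ∃ b : Module.Basis (ZMod p) k V, IsSteinbergBasis ρ b := by
  obtain ⟨v, hv, hEv⟩ := exists_isHighestWeightVector_unipotentSum_weylSL_eq_neg hirr hE
  have := hirr.nontrivial
  have hT := hv.torusSL_apply hirr hE
  set b : ZMod p → V := fun s => ρ (upperSL s) (ρ weylSL v)
  have hsum : -∑ s, b s = v := by rw [← unipotentSum_apply, hEv, neg_neg]
  have hborel : ∀ g : SpecialLinearGroup (Fin 2) (ZMod p), g 1 0 = 0 → ρ g v = -∑ s, b s := by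
    intro g hg
    obtain ⟨t, a, rfl⟩ := eq_torusSL_mul_upperSL hg
    rw [rep_mul_apply, hv.upper, hT, hsum]
  have hcell : ∀ g : SpecialLinearGroup (Fin 2) (ZMod p), g 1 0 ≠ 0 →
      ρ g v = b (g 0 0 / g 1 0) := by
    intro g hg
    conv_lhs => rw [eq_upperSL_mul_weylSL_mul hg]
    rw [rep_mul_apply, hv.upper, rep_mul_apply, hT, rep_mul_apply]
  have hact : ∀ (g : SpecialLinearGroup (Fin 2) (ZMod p)) (s : ZMod p),
      ρ g (b s) = ρ (g * (upperSL s * weylSL)) v := fun g s => by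
    rw [rep_mul_apply, rep_mul_apply]
  have hspan : Submodule.span k (Set.range b) = ⊤ := by
    have hmem : ∀ g, ρ g v ∈ Submodule.span k (Set.range b) := by
      intro g
      by_cases hg : g 1 0 = 0
      · rw [hborel g hg]
        exact neg_mem (sum_mem fun s _ => Submodule.subset_span ⟨s, rfl⟩)
      · rw [hcell g hg]
        exact Submodule.subset_span ⟨_, rfl⟩
    refine hirr.eq_top_of_invariant (fun g x hx => ?_) fun hbot => hv.ne_zero ?_
    · refine Submodule.span_induction ?_ (by simp) (fun x y _ _ hx hy => ?_)
        (fun c x _ hx => ?_) hx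
      · rintro _ ⟨s, rfl⟩
        rw [hact]
        exact hmem _
      · rw [map_add]; exact add_mem hx hy
      · rw [map_smul]; exact Submodule.smul_mem _ _ hx
    · rw [← Submodule.mem_bot k, ← hbot]
      simpa using hmem 1
  have hcard : Fintype.card (ZMod p) ≤ Module.finrank k V := by
    rw [ZMod.card]; exact le_finrank_of_unipotentSum_ne_zero hE
  refine ⟨Module.Basis.mk (linearIndependent_of_top_le_span_of_card_le_finrank hspan.ge hcard)
    hspan.ge, ?_⟩
  have h10 : ∀ (g : SpecialLinearGroup (Fin 2) (ZMod p)) (s : ZMod p),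
      (g * (upperSL s * weylSL) : SpecialLinearGroup (Fin 2) (ZMod p)) 1 0 =
        g 1 0 * s + g 1 1 := fun g s => by
    simp [Matrix.mul_apply, Fin.sum_univ_two]
  have h00 : ∀ (g : SpecialLinearGroup (Fin 2) (ZMod p)) (s : ZMod p),
      (g * (upperSL s * weylSL) : SpecialLinearGroup (Fin 2) (ZMod p)) 0 0 =
        g 0 0 * s + g 0 1 := fun g s => by
    simp [Matrix.mul_apply, Fin.sum_univ_two]
  constructor
  · intro g s hg
    rw [Module.Basis.coe_mk, hact, hcell _ (by rwa [h10]), h10, h00]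
  · intro g s hg
    rw [Module.Basis.coe_mk, hact, hborel _ (by rwa [h10])]

end CharP

namespace IsSteinbergBasis

variable {b : Module.Basis (ZMod p) k V}

theorem upperSL_apply (hb : IsSteinbergBasis ρ b) (a s : ZMod p) :
    ρ (upperSL a) (b s) = b (s + a) := by
  rw [hb.apply_of_ne_zero _ _ (by simp)]
  simp

/-- An operator commuting with the unipotent subgroup is a combination of its elements. -/
theorem eq_sum_smul (hb : IsSteinbergBasis ρ b) {X : Module.End k V}
    (hX : ∀ s : ZMod p, Commute X (ρ (upperSL s))) :
    X = ∑ a, b.repr (X (b 0)) a • ρ (upperSL a) := by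
  refine b.ext fun s => ?_
  have h₁ : X (b s) = ρ (upperSL s) (X (b 0)) := by
    rw [← Module.End.mul_apply, ← (hX s).eq, Module.End.mul_apply, hb.upperSL_apply, zero_add]
  rw [h₁]
  conv_lhs => rw [← b.sum_repr (X (b 0))]
  rw [map_sum, LinearMap.sum_apply]
  refine Finset.sum_congr rfl fun a _ => ?_
  rw [map_smul, LinearMap.smul_apply, hb.upperSL_apply, hb.upperSL_apply, add_comm]

theorem trace_eq_sum (hb : IsSteinbergBasis ρ b) (g : SpecialLinearGroup (Fin 2) (ZMod p)) :
    LinearMap.trace k V (ρ g) = ∑ s : ZMod p, if g 1 0 * s + g 1 1 = 0 then -1 else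
      if g 0 0 * s + g 0 1 = s * (g 1 0 * s + g 1 1) then (1 : k) else 0 := by
  rw [LinearMap.trace_eq_matrix_trace k b, Matrix.trace]
  refine Finset.sum_congr rfl fun s _ => ?_
  rw [Matrix.diag_apply, LinearMap.toMatrix_apply]
  split_ifs with h₁ h₂
  · rw [hb.apply_of_eq_zero g s h₁]
    simp [Finsupp.single_apply]
  · rw [hb.apply_of_ne_zero g s h₁, h₂, mul_div_cancel_right₀ _ h₁]
    simp
  · rw [hb.apply_of_ne_zero g s h₁, b.repr_self, Finsupp.single_eq_of_ne]
    exact fun h => ‹¬ _› ((div_eq_iff h₁).1 h.symm)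

theorem trace_upperSL_mul_torusSL (hb : IsSteinbergBasis ρ b) {t : (ZMod p)ˣ}
    (ht : (t : ZMod p) ^ 2 ≠ 1) (a : ZMod p) :
    LinearMap.trace k V (ρ (upperSL a * torusSL t)) = 1 := by
  have ht' : (t : ZMod p) ^ 2 - 1 ≠ 0 := sub_ne_zero.2 ht
  have ht0 : (t : ZMod p) ≠ 0 := t.ne_zero
  have e₀₀ : (upperSL a * torusSL t : SpecialLinearGroup (Fin 2) (ZMod p)) 0 0 = t := by
    simp [-ZMod.inv_coe_unit]
  have e₀₁ : (upperSL a * torusSL t : SpecialLinearGroup (Fin 2) (ZMod p)) 0 1 =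
      a * (t : ZMod p)⁻¹ := by simp [-ZMod.inv_coe_unit]
  have e₁₀ : (upperSL a * torusSL t : SpecialLinearGroup (Fin 2) (ZMod p)) 1 0 = 0 := by
    simp [-ZMod.inv_coe_unit]
  have e₁₁ : (upperSL a * torusSL t : SpecialLinearGroup (Fin 2) (ZMod p)) 1 1 =
      (t : ZMod p)⁻¹ := by simp [-ZMod.inv_coe_unit]
  rw [hb.trace_eq_sum, e₀₀, e₀₁, e₁₀, e₁₁]
  trans ∑ s : ZMod p, if s = -a / ((t : ZMod p) ^ 2 - 1) then (1 : k) else 0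
  · refine Finset.sum_congr rfl fun s _ => ?_
    have hiff : (t : ZMod p) * s + a * (t : ZMod p)⁻¹ = s * (t : ZMod p)⁻¹ ↔
        s = -a / ((t : ZMod p) ^ 2 - 1) := by
      rw [eq_div_iff ht']
      constructor
      · intro h
        field_simp at h
        linear_combination h
      · intro h
        field_simp
        linear_combination h
    simp only [zero_mul, zero_add, inv_eq_zero, ht0, if_false, hiff]
  · simp

theorem trace_upperSL_mul_weylSL_mul_torusSL (hb : IsSteinbergBasis ρ b) (hp2 : p ≠ 2)
    (φ : ZMod p →+* k) (y : ZMod p) (γ : (ZMod p)ˣ) :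
    LinearMap.trace k V (ρ (upperSL y * (weylSL * torusSL γ))) =
      φ (((y * γ) ^ 2 - 4) ^ (p / 2)) := by
  have h2 : (2 : ZMod p) ≠ 0 := two_ne_zero_zmod hp2
  have hchar : ringChar (ZMod p) ≠ 2 := by rwa [ZMod.ringChar_zmod_n]
  have hγ : (γ : ZMod p) ≠ 0 := γ.ne_zero
  have hbij : Function.Bijective fun s : ZMod p => 2 * γ * s - y * γ :=
    Finite.injective_iff_bijective.1 fun s r h =>
      mul_left_cancel₀ (mul_ne_zero h2 hγ) (sub_left_injective h)
  have hsplit : LinearMap.trace k V (ρ (upperSL y * (weylSL * torusSL γ))) =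
      ∑ s : ZMod p, ((if s = 0 then -1 else 0) +
        if (2 * γ * s - y * γ) ^ 2 = (y * γ) ^ 2 - 4 then (1 : k) else 0) := by
    have e₀₀ : (upperSL y * (weylSL * torusSL γ) : SpecialLinearGroup (Fin 2) (ZMod p)) 0 0 =
        y * γ := by simp [-ZMod.inv_coe_unit]
    have e₀₁ : (upperSL y * (weylSL * torusSL γ) : SpecialLinearGroup (Fin 2) (ZMod p)) 0 1 =
        -(γ : ZMod p)⁻¹ := by simp [-ZMod.inv_coe_unit]
    have e₁₀ : (upperSL y * (weylSL * torusSL γ) : SpecialLinearGroup (Fin 2) (ZMod p)) 1 0 =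
        γ := by simp [-ZMod.inv_coe_unit]
    have e₁₁ : (upperSL y * (weylSL * torusSL γ) : SpecialLinearGroup (Fin 2) (ZMod p)) 1 1 =
        0 := by simp [-ZMod.inv_coe_unit]
    rw [hb.trace_eq_sum, e₀₀, e₀₁, e₁₀, e₁₁]
    refine Finset.sum_congr rfl fun s _ => ?_
    by_cases hs : s = 0
    · have : ¬ (2 * γ * 0 - y * γ) ^ 2 = (y * γ) ^ 2 - 4 := fun h =>
        mul_ne_zero h2 h2 (by linear_combination h)
      rw [hs, if_neg this]
      simp only [mul_zero, add_zero, if_true]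
    · have hiff : y * γ * s + -(γ : ZMod p)⁻¹ = s * (γ * s) ↔
          (2 * γ * s - y * γ) ^ 2 = (y * γ) ^ 2 - 4 := by
        have hinv : (γ : ZMod p) * (γ : ZMod p)⁻¹ = 1 := mul_inv_cancel₀ hγ
        constructor
        · intro h
          linear_combination -4 * γ * h - 4 * hinv
        · intro h
          refine mul_left_cancel₀ (mul_ne_zero (mul_ne_zero h2 h2) hγ) ?_
          linear_combination -h - 4 * hinv
      simp only [add_zero, zero_add, mul_eq_zero, hγ, hs, or_self, if_false, hiff]
  have hcard : ∑ z : ZMod p, (if z ^ 2 = (y * γ) ^ 2 - 4 then (1 : k) else 0) =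
      ((quadraticChar (ZMod p) ((y * γ) ^ 2 - 4) + 1 : ℤ) : k) := by
    rw [← quadraticChar_card_sqrts hchar, Finset.sum_boole, Int.cast_natCast]
    congr 2
    ext
    simp
  rw [hsplit, Finset.sum_add_distrib, hbij.sum_comp
    (fun z : ZMod p => if z ^ 2 = (y * γ) ^ 2 - 4 then (1 : k) else 0), hcard,
    Finset.sum_ite_eq' Finset.univ (0 : ZMod p), if_pos (Finset.mem_univ _), Int.cast_add,
    Int.cast_one, neg_add_cancel_comm_assoc, ← map_intCast φ,
    quadraticChar_eq_pow_of_char_ne_two' hchar, ZMod.card]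

theorem eq_zero_of_mem_regularAnnihilator [CharP k p] (hb : IsSteinbergBasis ρ b) (hp : 5 ≤ p)
    {X : Module.End k V} (hX : X ∈ regularAnnihilator p ρ)
    (hcomm : ∀ s : ZMod p, Commute X (ρ (upperSL s))) : X = 0 := by
  have h2 : (2 : ZMod p) ≠ 0 := two_ne_zero_zmod (by omega)
  have h3 : (3 : ZMod p) ≠ 0 := by
    exact_mod_cast ZMod.prime_ne_zero p 3 (by omega)
  have hsum : ∀ g : SpecialLinearGroup (Fin 2) (ZMod p),
      trace (g : Matrix (Fin 2) (Fin 2) (ZMod p)) ^ 2 ≠ 4 →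
        ∑ a, b.repr (X (b 0)) a * LinearMap.trace k V (ρ (upperSL a * g)) = 0 := by
    intro g hg
    have h := hX g (not_dvd_orderOf_of_trace_sq_ne hg)
    rw [hb.eq_sum_smul hcomm, Finset.sum_mul, map_sum] at h
    rw [← h]
    refine Finset.sum_congr rfl fun a _ => ?_
    rw [smul_mul_assoc, map_smul, map_mul ρ, smul_eq_mul]
  have hmass : ∑ a, b.repr (X (b 0)) a = 0 := by
    have ht : ((Units.mk0 2 h2 : (ZMod p)ˣ) : ZMod p) ^ 2 ≠ 1 := fun h =>
      h3 (by rw [Units.val_mk0] at h; linear_combination h)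
    rw [← hsum (torusSL (Units.mk0 2 h2)) fun h => ?_]
    · simp_rw [hb.trace_upperSL_mul_torusSL ht, mul_one]
    · refine pow_ne_zero 2 h3 ?_
      simp only [coe_torusSL, trace_fin_two_of, Units.val_inv_eq_inv_val, Units.val_mk0] at h
      have hinv : (2 : ZMod p) * 2⁻¹ = 1 := mul_inv_cancel₀ h2
      linear_combination 4 * h - (8 + 2 * 2⁻¹ + 1) * hinv
  have hcoef := eq_zero_of_sum_mul_quadratic_eq_zero hp (ZMod.castHom dvd_rfl k) hmass
    (fun γ x hγ hx => by
      have htr : trace ((upperSL (x / γ) * (weylSL * torusSL (Units.mk0 γ hγ)) :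
          SpecialLinearGroup (Fin 2) (ZMod p)) : Matrix (Fin 2) (Fin 2) (ZMod p)) = x := by
        rw [trace_upperSL_mul]
        simp [trace_fin_two, Matrix.mul_apply, Fin.sum_univ_two, hγ]
      rw [← hsum (upperSL (x / γ) * (weylSL * torusSL (Units.mk0 γ hγ))) (by rwa [htr])]
      refine Finset.sum_congr rfl fun a _ => ?_
      rw [← mul_assoc (upperSL a), upperSL_mul, hb.trace_upperSL_mul_weylSL_mul_torusSL (by omega)
        (ZMod.castHom dvd_rfl k), Units.val_mk0, add_mul, div_mul_cancel₀ _ hγ, add_comm])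
  rw [hb.eq_sum_smul hcomm]
  exact Finset.sum_eq_zero fun a _ => by rw [hcoef a, zero_smul]

end IsSteinbergBasis

/-- A nonzero subspace stable under an operator of order dividing `p` contains a fixed vector. -/
theorem exists_fixed_of_pow_char_eq_one {W : Type*} [AddCommGroup W] [Module k W] [CharP k p]
    {L : Module.End k W} (hL : L ^ p = 1) {K : Submodule k W} (hK : ∀ x ∈ K, L x ∈ K)
    (hne : K ≠ ⊥) : ∃ x ∈ K, x ≠ 0 ∧ L x = x := by
  classical
  obtain ⟨x₀, hx₀, hx₀0⟩ := K.exists_mem_ne_zero_of_ne_bot hne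
  have : Nontrivial W := ⟨x₀, 0, hx₀0⟩
  have : CharP (Module.End k W) p :=
    charP_of_injective_algebraMap (algebraMap k (Module.End k W)).injective p
  have hnil : (L - 1) ^ p = 0 := by
    rw [sub_pow_char_of_commute _ (Commute.one_right _), one_pow, hL, sub_self]
  have hmem : ∀ n, ((L - 1) ^ n : Module.End k W) x₀ ∈ K := by
    intro n
    induction n with
    | zero => simpa using hx₀
    | succ n ih =>
      rw [pow_succ', Module.End.mul_apply, LinearMap.sub_apply, Module.End.one_apply]
      exact sub_mem (hK _ ih) ih
  have hex : ∃ n, ((L - 1) ^ n : Module.End k W) x₀ = 0 := ⟨p, by rw [hnil, LinearMap.zero_apply]⟩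
  have hpos : Nat.find hex ≠ 0 := fun h => hx₀0 (by simpa [h] using Nat.find_spec hex)
  obtain ⟨n, hn⟩ := Nat.exists_eq_succ_of_ne_zero hpos
  refine ⟨_, hmem n, Nat.find_min hex (by omega), ?_⟩
  have := Nat.find_spec hex
  rwa [hn, pow_succ', Module.End.mul_apply, LinearMap.sub_apply, Module.End.one_apply,
    sub_eq_zero] at this

theorem regularAnnihilator_eq_bot_of_unipotentSum_ne_zero [CharP k p] [FiniteDimensional k V]
    [IsAlgClosed k] (hirr : Irred ρ) (hE : unipotentSum ρ ≠ 0)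
    (hexc : ¬ (Module.finrank k V = p ∧ p ≤ 3)) : regularAnnihilator p ρ = ⊥ := by
  obtain ⟨b, hb⟩ := exists_isSteinbergBasis hirr hE
  have hp : 5 ≤ p := by
    have hdim : Module.finrank k V = p := by rw [Module.finrank_eq_card_basis b, ZMod.card]
    have h4 : p ≠ 4 := by
      rintro rfl
      exact absurd (Fact.out : Nat.Prime 4) (by norm_num)
    have : ¬ p ≤ 3 := fun h => hexc ⟨hdim, h⟩
    omega
  by_contra hne
  let L : Module.End k (Module.End k V) :=
    LinearMap.mulLeft k (ρ (upperSL 1)) * LinearMap.mulRight k (ρ (upperSL 1)⁻¹)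
  have hL : L ^ p = 1 := by
    change (_ * _) ^ p = 1
    rw [(LinearMap.commute_mulLeft_right (R := k) (ρ (upperSL 1)) (ρ (upperSL 1)⁻¹)).mul_pow,
      LinearMap.pow_mulLeft, LinearMap.pow_mulRight, ← map_pow, ← map_pow, inv_pow,
      upperSL_one_pow_char, inv_one, map_one, LinearMap.mulLeft_one, LinearMap.mulRight_one]
    rfl
  obtain ⟨X, hX, hX0, hfix⟩ := exists_fixed_of_pow_char_eq_one hL
    (fun Y hY => by
      have := conj_mem_regularAnnihilator hY (upperSL 1)
      rwa [mul_assoc] at this) hne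
  have hone : Commute X (ρ (upperSL 1)) := by
    have hinv : ρ (upperSL (1 : ZMod p))⁻¹ * ρ (upperSL 1) = 1 := by
      rw [← map_mul, inv_mul_cancel, map_one]
    have h : ρ (upperSL 1) * (X * ρ (upperSL 1)⁻¹) = X := hfix
    rw [commute_iff_eq]
    nth_rewrite 1 [← h]
    rw [mul_assoc, mul_assoc, hinv, mul_one]
  refine hX0 (hb.eq_zero_of_mem_regularAnnihilator hp hX fun s => ?_)
  rw [upperSL_eq_upperSL_one_pow, map_pow]
  exact hone.pow_right _

end SteinbergBasis

/-- Every nontrivial finite-dimensional irreducible representation of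
`SL₂(𝔽_p)` over an algebraically closed field `k` of characteristic `p` is weakly adequate,
except when `dim_k V = p` and `p ≤ 3`. -/
theorem statement_6 {p : ℕ} (hp : p.Prime) {k : Type} [Field k] [IsAlgClosed k] [CharP k p]
    {V : Type} [AddCommGroup V] [Module k V] [FiniteDimensional k V]
    (ρ : Representation k (Matrix.SpecialLinearGroup (Fin 2) (ZMod p)) V)
    (hnt : ∃ g, ρ g ≠ LinearMap.id) (hirr : Irred ρ)
    (hexc : ¬ (Module.finrank k V = p ∧ p ≤ 3)) :
    WeaklyAdequate ρ := by
  have := Fact.mk hp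
  refine weaklyAdequate_of_regularAnnihilator_eq_bot p ?_
  by_cases hE : unipotentSum ρ = 0
  · exact regularAnnihilator_eq_bot_of_sum_eq_zero hirr hE
  · exact regularAnnihilator_eq_bot_of_unipotentSum_ne_zero hirr hE hexc
end

section
/- Let p be an odd prime, let K be a field of characteristic p, let a be an integer with 0 ≤ a ≤ p−1, and let k be an integer with 0 ≤ k ≤ (p−1)/2 and k ≤ a. Define the differential operator Δ_k := Σ_{i=0}^{k} (−1)^{k−i} C(k,i)² X^i Y^{k−i} (∂/∂X)^i (∂/∂Y)^{k−i} acting on homogeneous polynomials of degree a in K[X,Y]. Then for each 0 ≤ ℓ ≤ a, the monomial X^ℓ Y^{a−ℓ} is an eigenvector of Δ_k with eigenvalue p_k(ℓ), where p_k(z) := Σ_{i=0}^{k} (−1)^{k−i} C(k,i)² · z(z−1)⋯(z−i+1) · (a−z)(a−z−1)⋯(a−z−k+i+1). Moreover, regarded as a polynomial in F_p[z], p_k has degree exactly k; its leading coefficient is Σ_{i=0}^{k} C(k,i)² = C(2k,k), which is nonzero modulo p since k < p/2. -/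
open MvPolynomial

/-- The differential operator
`Δ_k = Σ_{i=0}^{k} (−1)^{k−i} C(k,i)² X^i Y^{k−i} (∂/∂X)^i (∂/∂Y)^{k−i}`
on `K[X, Y]` (with `X = X 0`, `Y = X 1`). -/
noncomputable def Delta (K : Type*) [CommRing K] (kk : ℕ) :
    MvPolynomial (Fin 2) K →ₗ[K] MvPolynomial (Fin 2) K :=
  ∑ i ∈ Finset.range (kk + 1),
    ((-1 : ℤ) ^ (kk - i) * (kk.choose i : ℤ) ^ 2) •
      (LinearMap.mulLeft K ((X 0 : MvPolynomial (Fin 2) K) ^ i * (X 1) ^ (kk - i)) ∘ₗ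
        (((pderiv (0 : Fin 2)).toLinearMap ^ i) ∘ₗ
          ((pderiv (1 : Fin 2)).toLinearMap ^ (kk - i))))

/-- The scalar
`p_k(ℓ) = Σ_{i=0}^{k} (−1)^{k−i} C(k,i)² · ℓ(ℓ−1)⋯(ℓ−i+1) · (a−ℓ)(a−ℓ−1)⋯(a−ℓ−k+i+1)`,
computed in a commutative ring `K`. -/
noncomputable def eigval (K : Type*) [CommRing K] (a kk ℓ : ℕ) : K :=
  ∑ i ∈ Finset.range (kk + 1),
    ((-1 : ℤ) ^ (kk - i) * (kk.choose i : ℤ) ^ 2) •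
      ((∏ j ∈ Finset.range i, ((ℓ : K) - (j : K))) *
        (∏ j ∈ Finset.range (kk - i), ((a : K) - (ℓ : K) - (j : K))))

/-- The polynomial `p_k(z) ∈ 𝔽_p[z]` given by the same formula, with `z` a variable. -/
noncomputable def pkPoly (p a kk : ℕ) : Polynomial (ZMod p) :=
  ∑ i ∈ Finset.range (kk + 1),
    ((-1 : ℤ) ^ (kk - i) * (kk.choose i : ℤ) ^ 2) •
      ((∏ j ∈ Finset.range i, (Polynomial.X - Polynomial.C (j : ZMod p))) *
        (∏ j ∈ Finset.range (kk - i),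
          (Polynomial.C (a : ZMod p) - Polynomial.X - Polynomial.C (j : ZMod p))))

theorem cast_descFactorial_eq_prod_range_sub (R : Type*) [CommRing R] (l n : ℕ) :
    (l.descFactorial n : R) = ∏ j ∈ Finset.range n, ((l : R) - (j : R)) := by
  rw [← descPochhammer_eval_eq_descFactorial, descPochhammer_eval_eq_prod_range]

theorem pderiv_pow_apply_X_pow_mul {σ R : Type*} [CommRing R] (s : σ) (l n : ℕ)
    {q : MvPolynomial σ R} (hq : pderiv s q = 0) :
    ((pderiv s).toLinearMap ^ n) (X s ^ l * q) =
      (l.descFactorial n : R) • (X s ^ (l - n) * q) := by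
  induction n with
  | zero => simp
  | succ n ih =>
    rw [pow_succ', Module.End.mul_apply, ih, map_smul, Derivation.coeFn_coe, pderiv_mul,
      pderiv_pow, pderiv_X_self, hq, Nat.descFactorial_succ, Nat.sub_sub]
    simp only [MvPolynomial.smul_eq_C_mul, Nat.cast_mul, map_mul, map_natCast]
    ring

theorem X_pow_mul_descFactorial_smul_X_pow {σ R : Type*} [CommRing R] (s : σ) (l n : ℕ) :
    X s ^ n * ((l.descFactorial n : R) • (X s : MvPolynomial σ R) ^ (l - n)) =
      (∏ j ∈ Finset.range n, ((l : R) - (j : R))) • X s ^ l := by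
  rw [← cast_descFactorial_eq_prod_range_sub]
  rcases lt_or_ge l n with h | h
  · simp [Nat.descFactorial_of_lt h]
  · rw [mul_smul_comm, ← pow_add, Nat.add_sub_cancel' h]

theorem X_pow_mul_X_pow_mul_pderiv_pow_pderiv_pow_apply {R : Type*} [CommRing R] (l m i j : ℕ) :
    (X 0 ^ i * X 1 ^ j) * ((pderiv (0 : Fin 2)).toLinearMap ^ i)
        (((pderiv (1 : Fin 2)).toLinearMap ^ j) ((X 0 : MvPolynomial (Fin 2) R) ^ l * X 1 ^ m)) =
      ((∏ t ∈ Finset.range i, ((l : R) - (t : R))) *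
        ∏ t ∈ Finset.range j, ((m : R) - (t : R))) • (X 0 ^ l * X 1 ^ m) := by
  have hX (u : ℕ) : pderiv (1 : Fin 2) ((X 0 : MvPolynomial (Fin 2) R) ^ u) = 0 := by
    simp
  have hY (u : ℕ) : pderiv (0 : Fin 2) ((X 1 : MvPolynomial (Fin 2) R) ^ u) = 0 := by
    simp
  have hx := X_pow_mul_descFactorial_smul_X_pow (R := R) (0 : Fin 2) l i
  have hy := X_pow_mul_descFactorial_smul_X_pow (R := R) (1 : Fin 2) m j
  rw [mul_comm (X 0 ^ l) (X 1 ^ m), pderiv_pow_apply_X_pow_mul _ _ _ (hX l), map_smul,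
    mul_comm (X 1 ^ (m - j)), pderiv_pow_apply_X_pow_mul _ _ _ (hY (m - j))]
  simp only [MvPolynomial.smul_eq_C_mul, map_mul] at hx hy ⊢
  rw [mul_comm (X 1 ^ m), mul_mul_mul_comm (C _), ← hx, ← hy]
  ring

theorem Delta_apply_monomial (K : Type*) [CommRing K] (kk : ℕ) {a l : ℕ} (hl : l ≤ a) :
    Delta K kk ((X 0 : MvPolynomial (Fin 2) K) ^ l * (X 1) ^ (a - l)) =
      eigval K a kk l • ((X 0 : MvPolynomial (Fin 2) K) ^ l * (X 1) ^ (a - l)) := by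
  simp only [Delta, eigval, LinearMap.sum_apply, LinearMap.smul_apply, LinearMap.comp_apply,
    LinearMap.mulLeft_apply, X_pow_mul_X_pow_mul_pderiv_pow_pderiv_pow_apply, Finset.sum_smul,
    smul_assoc, Nat.cast_sub hl]

theorem eval_pkPoly (p a kk l : ℕ) :
    Polynomial.eval (l : ZMod p) (pkPoly p a kk) = eigval (ZMod p) a kk l := by
  simp [pkPoly, eigval, Polynomial.eval_finsetSum, Polynomial.eval_prod]

open Polynomial in
theorem natDegree_prod_range_le {R : Type*} [CommRing R] (f : ℕ → R[X])
    (hf : ∀ j, (f j).natDegree ≤ 1) (n : ℕ) :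
    (∏ j ∈ Finset.range n, f j).natDegree ≤ n :=
  (natDegree_prod_le _ _).trans <|
    (Finset.sum_le_card_nsmul _ _ 1 fun j _ => hf j).trans (by simp)

open Polynomial in
theorem coeff_prod_range {R : Type*} [CommRing R] (f : ℕ → R[X])
    (hf : ∀ j, (f j).natDegree ≤ 1) (n : ℕ) :
    (∏ j ∈ Finset.range n, f j).coeff n = ∏ j ∈ Finset.range n, (f j).coeff 1 := by
  simpa using coeff_prod_of_natDegree_le (Finset.range n) f 1 fun j _ => hf j

theorem natDegree_X_sub_C_le_one {R : Type*} [CommRing R] (c : R) :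
    (Polynomial.X - Polynomial.C c).natDegree ≤ 1 := by
  compute_degree

theorem natDegree_C_sub_X_sub_C_le_one {R : Type*} [CommRing R] (b c : R) :
    (Polynomial.C b - Polynomial.X - Polynomial.C c).natDegree ≤ 1 := by
  compute_degree

theorem natDegree_pkPoly_le (p a kk : ℕ) : (pkPoly p a kk).natDegree ≤ kk := by
  refine Polynomial.natDegree_sum_le_of_forall_le _ _ fun i hi => ?_
  refine (Polynomial.natDegree_smul_le _ _).trans (Polynomial.natDegree_mul_le.trans ?_)
  have hx := natDegree_prod_range_le _ (fun j => natDegree_X_sub_C_le_one (j : ZMod p)) i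
  have hy := natDegree_prod_range_le _
    (fun j => natDegree_C_sub_X_sub_C_le_one (a : ZMod p) (j : ZMod p)) (kk - i)
  have := Finset.mem_range.1 hi
  omega

theorem coeff_pkPoly (p a kk : ℕ) :
    (pkPoly p a kk).coeff kk = ((2 * kk).choose kk : ZMod p) := by
  rw [← Nat.sum_range_choose_sq, pkPoly, Polynomial.finsetSum_coeff, Nat.cast_sum]
  refine Finset.sum_congr rfl fun i hi => ?_
  have hik : i + (kk - i) = kk := Nat.add_sub_cancel' (Nat.lt_succ_iff.1 (Finset.mem_range.1 hi))
  have hx (j : ℕ) := natDegree_X_sub_C_le_one (j : ZMod p)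
  have hy (j : ℕ) := natDegree_C_sub_X_sub_C_le_one (a : ZMod p) (j : ZMod p)
  have hc := Polynomial.coeff_mul_add_eq_of_natDegree_le
    (natDegree_prod_range_le _ hx i) (natDegree_prod_range_le _ hy (kk - i))
  rw [hik, coeff_prod_range _ hx, coeff_prod_range _ hy] at hc
  rw [Polynomial.coeff_smul, hc]
  simp only [Polynomial.coeff_sub, Polynomial.coeff_X_one, Polynomial.coeff_C_succ, sub_zero,
    zero_sub, Finset.prod_const, Finset.card_range, one_pow, one_mul, zsmul_eq_mul]
  push_cast
  rw [mul_right_comm, ← mul_pow]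
  simp

theorem cast_choose_two_mul_ne_zero {p kk : ℕ} (hp : p.Prime) (hk : 2 * kk < p) :
    ((2 * kk).choose kk : ZMod p) ≠ 0 := by
  rw [Ne, ZMod.natCast_eq_zero_iff]
  intro h
  have hdvd : (2 * kk).choose kk ∣ (2 * kk).factorial := by
    rw [← Nat.choose_mul_factorial_mul_factorial (show kk ≤ 2 * kk by omega), mul_assoc]
    exact dvd_mul_right _ _
  have := (hp.dvd_factorial).1 (h.trans hdvd)
  omega

/-- Lemmas 3.4 and 3.5.  Let `p` be an odd prime, `K` a field of
characteristic `p`, `0 ≤ a ≤ p − 1` and `0 ≤ k ≤ (p−1)/2` with `k ≤ a`.  Then each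
monomial `X^ℓ Y^{a−ℓ}` (`0 ≤ ℓ ≤ a`) is an eigenvector of `Δ_k` with eigenvalue `p_k(ℓ)`;
moreover `p_k ∈ 𝔽_p[z]` has degree exactly `k`, with leading coefficient
`Σ_i C(k,i)² = C(2k,k) ≢ 0 (mod p)`. -/
theorem statement_7 {p : ℕ} (hp : p.Prime) (hodd : Odd p)
    {K : Type} [Field K] [CharP K p]
    {a kk : ℕ} (ha : a ≤ p - 1) (hk : 2 * kk ≤ p - 1) (hka : kk ≤ a) :
    (∀ ℓ : ℕ, ℓ ≤ a →
      Delta K kk ((X 0 : MvPolynomial (Fin 2) K) ^ ℓ * (X 1) ^ (a - ℓ)) =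
        eigval K a kk ℓ • ((X 0 : MvPolynomial (Fin 2) K) ^ ℓ * (X 1) ^ (a - ℓ))) ∧
    (∀ ℓ : ℕ, Polynomial.eval (ℓ : ZMod p) (pkPoly p a kk) = eigval (ZMod p) a kk ℓ) ∧
    (pkPoly p a kk).natDegree = kk ∧
    (∑ i ∈ Finset.range (kk + 1), (kk.choose i) ^ 2 = (2 * kk).choose kk) ∧
    (pkPoly p a kk).coeff kk = ((2 * kk).choose kk : ZMod p) ∧
    ((2 * kk).choose kk : ZMod p) ≠ 0 := by
  have hp0 := hp.pos
  have hne := cast_choose_two_mul_ne_zero hp (show 2 * kk < p by omega)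
  exact ⟨fun _ hl => Delta_apply_monomial K kk hl, eval_pkPoly p a kk,
    Polynomial.natDegree_eq_of_le_of_coeff_ne_zero (natDegree_pkPoly_le p a kk)
      (by rwa [coeff_pkPoly]),
    Nat.sum_range_choose_sq kk, coeff_pkPoly p a kk, hne⟩
end

section
/- Let k be a field, G a finite group, and E a kG-module of finite length with submodules X and M. Let N ≤ G be a subgroup. Suppose that, as kN-modules, X and E/X have no composition factor in common (up to isomorphism), and that for every composition factor C of X as a kN-module, the multiplicity of C as a composition factor of X is at most its multiplicity as a composition factor of M (as kN-modules). Then M ⊇ X. -/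
section RepDefs

variable {k G V : Type*} [Field k] [Group G] [AddCommGroup V] [Module k V]

/-- `c` is a composition series, as `kH`-modules, of the subquotient `B/A`: a chain of
`H`-stable submodules from `A` to `B` each of whose successive factors is simple. -/
def IsCompSeries (ρ : Representation k G V) (H : Subgroup G) (A B : Submodule k V)
    {n : ℕ} (c : Fin (n + 1) → Submodule k V) : Prop :=
  c 0 = A ∧ c (Fin.last n) = B ∧ Monotone c ∧
    (∀ i : Fin (n + 1), IsInvt ρ H (c i)) ∧
    ∀ i : Fin n, c i.castSucc ≠ c i.succ ∧
      ∀ U : Submodule k V, IsInvt ρ H U → c i.castSucc ≤ U → U ≤ c i.succ →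
        U = c i.castSucc ∨ U = c i.succ

/-- The subquotients `B₁/A₁` and `B₂/A₂` of `V` are isomorphic as `kH`-modules.
This is encoded, without forming quotients, by the existence of an `H`-stable submodule
`D ≤ B₁ × B₂` containing `A₁ × A₂` which induces the graph of such an isomorphism. -/
def FactorIso (ρ : Representation k G V) (H : Subgroup G)
    (A₁ B₁ A₂ B₂ : Submodule k V) : Prop :=
  ∃ D : Submodule k (V × V),
    (∀ g ∈ H, ∀ x ∈ D, ((ρ g x.1, ρ g x.2) : V × V) ∈ D) ∧
    (∀ x ∈ D, x.1 ∈ B₁ ∧ x.2 ∈ B₂) ∧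
    (∀ a₁ ∈ A₁, ∀ a₂ ∈ A₂, ((a₁, a₂) : V × V) ∈ D) ∧
    (∀ x ∈ D, (x.1 ∈ A₁ ↔ x.2 ∈ A₂)) ∧
    (∀ b₁ ∈ B₁, ∃ b₂ : V, ((b₁, b₂) : V × V) ∈ D) ∧
    (∀ b₂ ∈ B₂, ∃ b₁ : V, ((b₁, b₂) : V × V) ∈ D)

end RepDefs

section FactorLemmas

variable {k G V : Type*} [Field k] [Group G] [AddCommGroup V] [Module k V]
  {ρ : Representation k G V} {H : Subgroup G}

theorem IsInvt.inf {U W : Submodule k V} (hU : IsInvt ρ H U) (hW : IsInvt ρ H W) :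
    IsInvt ρ H (U ⊓ W) :=
  fun g hg v hv => ⟨hU g hg v hv.1, hW g hg v hv.2⟩

theorem IsInvt.sup {U W : Submodule k V} (hU : IsInvt ρ H U) (hW : IsInvt ρ H W) :
    IsInvt ρ H (U ⊔ W) := by
  intro g hg v hv
  obtain ⟨u, hu, w, hw, rfl⟩ := Submodule.mem_sup.1 hv
  rw [map_add]
  exact Submodule.add_mem_sup (hU g hg u hu) (hW g hg w hw)

theorem FactorIso.refl {A B : Submodule k V} (hA : IsInvt ρ H A) (hB : IsInvt ρ H B)
    (hAB : A ≤ B) : FactorIso ρ H A B A B := by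
  refine ⟨B.prod B ⊓ A.comap (LinearMap.fst k V V - LinearMap.snd k V V), ?_, ?_, ?_, ?_, ?_, ?_⟩
  · rintro g hg ⟨x, y⟩ ⟨⟨hx, hy⟩, hxy⟩
    refine ⟨⟨hB g hg x hx, hB g hg y hy⟩, ?_⟩
    have := hA g hg _ hxy
    simpa using this
  · rintro ⟨x, y⟩ ⟨⟨hx, hy⟩, -⟩
    exact ⟨hx, hy⟩
  · intro a ha b hb
    exact ⟨⟨hAB ha, hAB hb⟩, by simpa using A.sub_mem ha hb⟩
  · rintro ⟨x, y⟩ ⟨-, hxy⟩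
    have h : x - y ∈ A := by simpa using hxy
    exact ⟨fun hx => by simpa using A.sub_mem hx h, fun hy => by simpa using A.add_mem h hy⟩
  · exact fun b hb => ⟨b, ⟨hb, hb⟩, by simp⟩
  · exact fun b hb => ⟨b, ⟨hb, hb⟩, by simp⟩

theorem FactorIso.symm {A₁ B₁ A₂ B₂ : Submodule k V} (h : FactorIso ρ H A₁ B₁ A₂ B₂) :
    FactorIso ρ H A₂ B₂ A₁ B₁ := by
  obtain ⟨D, hinv, hB, hA, hiff, hl, hr⟩ := h
  refine ⟨D.comap (LinearMap.prod (LinearMap.snd k V V) (LinearMap.fst k V V)),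
    fun g hg x hx => hinv g hg _ hx, fun x hx => (hB _ hx).symm,
    fun a ha b hb => hA b hb a ha, fun x hx => (hiff _ hx).symm, hr, hl⟩

theorem FactorIso.trans {A₁ B₁ A₂ B₂ A₃ B₃ : Submodule k V}
    (h : FactorIso ρ H A₁ B₁ A₂ B₂) (h' : FactorIso ρ H A₂ B₂ A₃ B₃) :
    FactorIso ρ H A₁ B₁ A₃ B₃ := by
  obtain ⟨D, hinv, hB, hA, hiff, hl, hr⟩ := h
  obtain ⟨D', hinv', hB', hA', hiff', hl', hr'⟩ := h'
  let F : Submodule k (V × V) :=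
    { carrier := {x | ∃ y, (x.1, y) ∈ D ∧ (y, x.2) ∈ D'}
      add_mem' := by
        rintro a b ⟨y, h₁, h₂⟩ ⟨z, h₃, h₄⟩
        exact ⟨y + z, D.add_mem h₁ h₃, D'.add_mem h₂ h₄⟩
      zero_mem' := ⟨0, D.zero_mem, D'.zero_mem⟩
      smul_mem' := by
        rintro t a ⟨y, h₁, h₂⟩
        exact ⟨t • y, D.smul_mem t h₁, D'.smul_mem t h₂⟩ }
  refine ⟨F, ?_, ?_, ?_, ?_, ?_, ?_⟩
  · rintro g hg x ⟨y, h₁, h₂⟩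
    exact ⟨ρ g y, hinv g hg _ h₁, hinv' g hg _ h₂⟩
  · rintro x ⟨y, h₁, h₂⟩
    exact ⟨(hB _ h₁).1, (hB' _ h₂).2⟩
  · intro a ha b hb
    exact ⟨0, hA a ha 0 A₂.zero_mem, hA' 0 A₂.zero_mem b hb⟩
  · rintro x ⟨y, h₁, h₂⟩
    exact (hiff _ h₁).trans (hiff' _ h₂)
  · intro b hb
    obtain ⟨y, hy⟩ := hl b hb
    obtain ⟨z, hz⟩ := hl' y (hB _ hy).2
    exact ⟨z, y, hy, hz⟩
  · intro b hb
    obtain ⟨y, hy⟩ := hr' b hb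
    obtain ⟨z, hz⟩ := hr y (hB' _ hy).1
    exact ⟨z, y, hz, hy⟩

/-- `B/A` is a simple `kH`-subquotient of `V`. -/
structure IsSimpleFactor (ρ : Representation k G V) (H : Subgroup G) (A B : Submodule k V) :
    Prop where
  invt_left : IsInvt ρ H A
  invt_right : IsInvt ρ H B
  le : A ≤ B
  ne : A ≠ B
  eq_or_eq : ∀ U : Submodule k V, IsInvt ρ H U → A ≤ U → U ≤ B → U = A ∨ U = B

theorem IsCompSeries.isSimpleFactor {A B : Submodule k V} {n : ℕ}
    {c : Fin (n + 1) → Submodule k V} (hc : IsCompSeries ρ H A B c) (i : Fin n) :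
    IsSimpleFactor ρ H (c i.castSucc) (c i.succ) where
  invt_left := hc.2.2.2.1 _
  invt_right := hc.2.2.2.1 _
  le := hc.2.2.1 i.castSucc_le_succ
  ne := (hc.2.2.2.2 i).1
  eq_or_eq := (hc.2.2.2.2 i).2

/-- The filtration step `C ≤ D` is the one at which the factor `B/A` appears. -/
def IsLinked (A B C D : Submodule k V) : Prop :=
  B ⊓ C ≤ A ∧ ¬ B ⊓ D ≤ A

theorem exists_isLinked {A B : Submodule k V} {n : ℕ} (c : Fin (n + 1) → Submodule k V)
    (h₀ : B ⊓ c 0 ≤ A) (h₁ : ¬ B ⊓ c (Fin.last n) ≤ A) :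
    ∃ i : Fin n, IsLinked A B (c i.castSucc) (c i.succ) := by
  by_contra! h
  refine h₁ (Fin.induction (motive := fun i => B ⊓ c i ≤ A) h₀ (fun i hi => ?_) (Fin.last n))
  by_contra hi'
  exact h i ⟨hi, hi'⟩

section Linked

variable {A B C D : Submodule k V}

theorem IsLinked.left_le_sup (hl : IsLinked A B C D) (hAB : IsSimpleFactor ρ H A B)
    (hD : IsInvt ρ H D) : B ≤ A ⊔ B ⊓ D := by
  rcases hAB.eq_or_eq (A ⊔ B ⊓ D) (hAB.invt_left.sup (hAB.invt_right.inf hD)) le_sup_left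
    (sup_le hAB.le inf_le_left) with h | h
  · exact absurd (h ▸ le_sup_right) hl.2
  · exact h.ge

theorem IsLinked.right_le_sup (hl : IsLinked A B C D) (hCD : IsSimpleFactor ρ H C D)
    (hB : IsInvt ρ H B) : D ≤ C ⊔ B ⊓ D := by
  rcases hCD.eq_or_eq (C ⊔ B ⊓ D) (hCD.invt_left.sup (hB.inf hCD.invt_right)) le_sup_left
    (sup_le hCD.le inf_le_right) with h | h
  · have hC : B ⊓ D ≤ C := h ▸ le_sup_right
    exact absurd ((le_inf inf_le_left hC).trans hl.1) hl.2
  · exact h.ge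

theorem IsLinked.inf_le (hl : IsLinked A B C D) (hCD : IsSimpleFactor ρ H C D)
    (hA : IsInvt ρ H A) (hAB : A ≤ B) : A ⊓ D ≤ C := by
  rcases hCD.eq_or_eq (C ⊔ A ⊓ D) (hCD.invt_left.sup (hA.inf hCD.invt_right)) le_sup_left
    (sup_le hCD.le inf_le_right) with h | h
  · exact h ▸ le_sup_right
  · refine absurd (fun x hx => ?_) hl.2
    have hxD : x ∈ C ⊔ A ⊓ D := h.ge hx.2
    obtain ⟨c, hc, a, ha, rfl⟩ := Submodule.mem_sup.1 hxD
    have hcB : c ∈ B := by simpa using B.sub_mem hx.1 (hAB ha.1)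
    exact A.add_mem (hl.1 ⟨hcB, hc⟩) ha.1

theorem IsLinked.factorIso (hl : IsLinked A B C D) (hAB : IsSimpleFactor ρ H A B)
    (hCD : IsSimpleFactor ρ H C D) : FactorIso ρ H A B C D := by
  have hAC := hl.inf_le hCD hAB.invt_left hAB.le
  let F : Submodule k (V × V) :=
    { carrier := {x | ∃ w ∈ B ⊓ D, x.1 - w ∈ A ∧ x.2 - w ∈ C}
      add_mem' := by
        rintro a b ⟨y, hy, h₁, h₂⟩ ⟨z, hz, h₃, h₄⟩
        refine ⟨y + z, (B ⊓ D).add_mem hy hz, ?_, ?_⟩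
        · simpa [add_sub_add_comm] using A.add_mem h₁ h₃
        · simpa [add_sub_add_comm] using C.add_mem h₂ h₄
      zero_mem' := ⟨0, (B ⊓ D).zero_mem, by simp, by simp⟩
      smul_mem' := by
        rintro t a ⟨y, hy, h₁, h₂⟩
        refine ⟨t • y, (B ⊓ D).smul_mem t hy, ?_, ?_⟩
        · simpa [smul_sub] using A.smul_mem t h₁
        · simpa [smul_sub] using C.smul_mem t h₂ }
  refine ⟨F, ?_, ?_, ?_, ?_, ?_, ?_⟩
  · rintro g hg x ⟨w, hw, h₁, h₂⟩
    refine ⟨ρ g w, (hAB.invt_right.inf hCD.invt_right) g hg w hw, ?_, ?_⟩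
    · simpa using hAB.invt_left g hg _ h₁
    · simpa using hCD.invt_left g hg _ h₂
  · rintro x ⟨w, hw, h₁, h₂⟩
    exact ⟨by simpa using B.add_mem (hAB.le h₁) hw.1, by simpa using D.add_mem (hCD.le h₂) hw.2⟩
  · exact fun a ha c hc => ⟨0, (B ⊓ D).zero_mem, by simpa using ha, by simpa using hc⟩
  · rintro x ⟨w, hw, h₁, h₂⟩
    constructor
    · intro hx
      have hwA : w ∈ A := by simpa using A.sub_mem hx h₁
      simpa using C.add_mem h₂ (hAC ⟨hwA, hw.2⟩)
    · intro hx
      have hwC : w ∈ C := by simpa using C.sub_mem hx h₂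
      simpa using A.add_mem h₁ (hl.1 ⟨hw.1, hwC⟩)
  · intro b hb
    obtain ⟨a, ha, w, hw, rfl⟩ := Submodule.mem_sup.1 (hl.left_le_sup hAB hCD.invt_right hb)
    exact ⟨w, w, hw, by simpa using ha, by simp⟩
  · intro d hd
    obtain ⟨c, hc, w, hw, rfl⟩ := Submodule.mem_sup.1 (hl.right_le_sup hCD hAB.invt_right hd)
    exact ⟨w, w, hw, by simp, by simpa using hc⟩

end Linked

/-- Distinct factors of a composition series are linked to distinct simple factors. -/
theorem IsCompSeries.eq_of_isLinked {P Q C D : Submodule k V} {n : ℕ}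
    {c : Fin (n + 1) → Submodule k V} (hc : IsCompSeries ρ H P Q c)
    (hCD : IsSimpleFactor ρ H C D) {i j : Fin n}
    (hi : IsLinked (c i.castSucc) (c i.succ) C D)
    (hj : IsLinked (c j.castSucc) (c j.succ) C D) : i = j := by
  have h_not_lt : ∀ {i j : Fin n}, IsLinked (c i.castSucc) (c i.succ) C D →
      IsLinked (c j.castSucc) (c j.succ) C D → ¬ i < j := by
    intro i j hi hj hij
    have hsi := hc.isSimpleFactor i
    have hsj := hc.isSimpleFactor j
    have hle : c i.succ ≤ c j.castSucc := hc.2.2.1 (Fin.succ_le_castSucc_iff.2 hij)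
    refine hCD.ne (hCD.le.antisymm ((hi.right_le_sup hCD hsi.invt_right).trans ?_))
    exact sup_le le_rfl ((inf_le_inf_right D hle).trans (hj.inf_le hCD hsj.invt_left hsj.le))
  exact le_antisymm (not_lt.1 (h_not_lt hj hi)) (not_lt.1 (h_not_lt hi hj))

end FactorLemmas

/-- Let `E` be a `kG`-module of finite length with submodules `X`, `M`,
and let `N ≤ G`.  If, as `kN`-modules, `X` and `E/X` have no composition factor in common
and the multiplicity of every composition factor of `X` is at most its multiplicity in
`M`, then `M ⊇ X`. -/
theorem statement_9 {k : Type} [Field k] {G : Type} [Group G]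
    {E : Type} [AddCommGroup E] [Module k E]
    (ρ : Representation k G E) (N : Subgroup G)
    (X M : Submodule k E) (hX : IsInvt ρ ⊤ X) (hM : IsInvt ρ ⊤ M)
    {m n r : ℕ}
    -- a composition series of `X` as a `kN`-module:
    (cX : Fin (m + 1) → Submodule k E) (hcX : IsCompSeries ρ N ⊥ X cX)
    -- a composition series of `E/X` as a `kN`-module:
    (cQ : Fin (n + 1) → Submodule k E) (hcQ : IsCompSeries ρ N X ⊤ cQ)
    -- a composition series of `M` as a `kN`-module:
    (cM : Fin (r + 1) → Submodule k E) (hcM : IsCompSeries ρ N ⊥ M cM)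
    -- `X` and `E/X` share no composition factor:
    (hdisj : ∀ (i : Fin m) (j : Fin n),
      ¬ FactorIso ρ N (cX i.castSucc) (cX i.succ) (cQ j.castSucc) (cQ j.succ))
    -- each composition factor of `X` occurs in `M` with at least the same multiplicity:
    (hmult : ∀ i : Fin m,
      Nat.card {i' : Fin m //
        FactorIso ρ N (cX i'.castSucc) (cX i'.succ) (cX i.castSucc) (cX i.succ)} ≤
      Nat.card {j : Fin r //
        FactorIso ρ N (cM j.castSucc) (cM j.succ) (cX i.castSucc) (cX i.succ)}) :
    X ≤ M := by
  have exists_link : ∀ (i : Fin m) (j : Fin r),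
      FactorIso ρ N (cM j.castSucc) (cM j.succ) (cX i.castSucc) (cX i.succ) →
      ∃ i' : Fin m, IsLinked (cM j.castSucc) (cM j.succ) (cX i'.castSucc) (cX i'.succ) := by
    intro i j hij
    have hj := hcM.isSimpleFactor j
    apply exists_isLinked cX
    · simp [hcX.1]
    · rw [hcX.2.1]
      intro hXj
      obtain ⟨l, hl⟩ := exists_isLinked (A := cM j.castSucc) (B := cM j.succ) cQ
        (by rwa [hcQ.1]) (by
          rw [hcQ.2.1, inf_top_eq]
          exact fun h => hj.ne (hj.le.antisymm h))
      exact hdisj i l (hij.symm.trans (hl.factorIso hj (hcQ.isSimpleFactor l)))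
  have exists_link_of_factor : ∀ i : Fin m, ∃ j : Fin r,
      IsLinked (cM j.castSucc) (cM j.succ) (cX i.castSucc) (cX i.succ) := by
    intro i
    choose f hf using exists_link i
    let φ : {j : Fin r //
          FactorIso ρ N (cM j.castSucc) (cM j.succ) (cX i.castSucc) (cX i.succ)} →
        {i' : Fin m //
          FactorIso ρ N (cX i'.castSucc) (cX i'.succ) (cX i.castSucc) (cX i.succ)} :=
      fun j => ⟨f j.1 j.2, ((hf j.1 j.2).factorIso (hcM.isSimpleFactor _)
        (hcX.isSimpleFactor _)).symm.trans j.2⟩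
    have hφ : Function.Injective φ := by
      intro j j' h
      have hfj : f j.1 j.2 = f j'.1 j'.2 := congrArg Subtype.val h
      exact Subtype.ext (hcM.eq_of_isLinked (hcX.isSimpleFactor _) (hf j.1 j.2)
        (hfj ▸ hf j'.1 j'.2))
    have hi := hcX.isSimpleFactor i
    obtain ⟨j, hj⟩ := (hφ.bijective_of_nat_card_le (hmult i)).2
      ⟨i, FactorIso.refl hi.invt_left hi.invt_right hi.le⟩
    have hfj : f j.1 j.2 = i := congrArg Subtype.val hj
    have hlink := hf j.1 j.2
    rw [hfj] at hlink
    exact ⟨j.1, hlink⟩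
  rw [← hcX.2.1]
  refine Fin.induction (motive := fun i => cX i ≤ M) (by simp [hcX.1]) (fun i hi => ?_) (Fin.last m)
  obtain ⟨j, hj⟩ := exists_link_of_factor i
  have hjM : cM j.succ ≤ M := hcM.2.1 ▸ hcM.2.2.1 (Fin.le_last _)
  exact (hj.right_le_sup (hcX.isSimpleFactor i) (hcM.isSimpleFactor j).invt_right).trans
    (sup_le hi (inf_le_left.trans hjM))
end

section
/- Let k be a field of characteristic p > 0, X a finite group, N a normal subgroup of X, and let A and B be finite-dimensional k(X/N)-modules, regarded also as kX-modules by inflation along X → X/N. Then: (i) if every short exact sequence of kX-modules 0 → B → E → A → 0 splits, then every short exact sequence of k(X/N)-modules 0 → B → E → A → 0 splits; and (ii) if every short exact sequence of k(X/N)-modules 0 → B → E → A → 0 splits and N has no nontrivial quotient that is a p-group (i.e. the only normal subgroup M of N with N/M a p-group is M = N), then every short exact sequence of kX-modules 0 → B → E → A → 0 splits. -/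
universe u v w

/-- `Ext¹_G(A, B) = 0`: every short exact sequence `0 → B → E → A → 0` of `kG`-modules
splits. -/
def ExtOneZero {k : Type u} [Field k] {G : Type v} [Group G]
    {A : Type w} [AddCommGroup A] [Module k A]
    {B : Type w} [AddCommGroup B] [Module k B]
    (ρA : Representation k G A) (ρB : Representation k G B) : Prop :=
  ∀ (E : Type w) [AddCommGroup E] [Module k E], ∀ (σ : Representation k G E)
    (ι : B →ₗ[k] E) (π : E →ₗ[k] A),
    Function.Injective ι → Function.Surjective π → LinearMap.ker π = LinearMap.range ι →
    (∀ g : G, ι ∘ₗ ρB g = σ g ∘ₗ ι) → (∀ g : G, π ∘ₗ σ g = ρA g ∘ₗ π) →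
    ∃ s : A →ₗ[k] E, (∀ g : G, s ∘ₗ ρA g = σ g ∘ₗ s) ∧ π ∘ₗ s = LinearMap.id

/-- Vanishing of `Ext¹` descends along a surjective group homomorphism. -/
theorem ExtOneZero.of_comp_surjective {k : Type u} [Field k] {G H : Type*} [Group G] [Group H]
    {A B : Type w} [AddCommGroup A] [Module k A] [AddCommGroup B] [Module k B]
    {ρA : Representation k H A} {ρB : Representation k H B} {f : G →* H}
    (hf : Function.Surjective f) (h : ExtOneZero (ρA.comp f) (ρB.comp f)) :
    ExtOneZero ρA ρB := by
  intro E _ _ σ ι π hι hπ hex hιeq hπeq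
  obtain ⟨s, hs, hπs⟩ :=
    h E (σ.comp f) ι π hι hπ hex (fun g => hιeq (f g)) (fun g => hπeq (f g))
  exact ⟨s, hf.forall.2 hs, hπs⟩

/-- In characteristic `p`, an endomorphism acting trivially on the image of `ι` and on the
quotient by the kernel of `π`, where `ker π ≤ range ι`, has trivial `p`-th power. -/
theorem pow_char_eq_one_of_trivial_on_sub_quotient {k A B E : Type*} [Field k] (p : ℕ) [CharP k p]
    [AddCommGroup A] [Module k A] [AddCommGroup B] [Module k B] [AddCommGroup E] [Module k E]
    (ι : B →ₗ[k] E) (π : E →ₗ[k] A) (hex : LinearMap.ker π ≤ LinearMap.range ι)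
    {T : Module.End k E} (hB : T ∘ₗ ι = ι) (hA : π ∘ₗ T = π) : T ^ p = 1 := by
  have hfix : ∀ e, T (T e - e) = T e - e := by
    intro e
    obtain ⟨b, hb⟩ : T e - e ∈ LinearMap.range ι := by
      refine hex ?_
      rw [LinearMap.mem_ker, map_sub, sub_eq_zero]
      exact LinearMap.congr_fun hA e
    rw [← hb]
    exact LinearMap.congr_fun hB b
  have hpow : ∀ (m : ℕ) (e : E), (T ^ m) e = e + (m : k) • (T e - e) := by
    intro m e
    induction m with
    | zero => simp
    | succ m ih =>
      rw [pow_succ', Module.End.mul_apply, ih, map_add, map_smul, hfix]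
      push_cast
      module
  ext e
  rw [hpow, CharP.cast_eq_zero, zero_smul, add_zero, Module.End.one_apply]

/-- Let `k` be a field of characteristic `p > 0`, `X` a finite group,
`N ⊴ X`, and `A`, `B` finite-dimensional `k(X/N)`-modules, inflated to `kX`-modules.
(i) If `Ext¹_X(A, B) = 0` then `Ext¹_{X/N}(A, B) = 0`.
(ii) If `Ext¹_{X/N}(A, B) = 0` and `N` has no nontrivial `p`-group quotient
(`O^p(N) = N`), then `Ext¹_X(A, B) = 0`. -/
theorem statement_13 {k : Type} [Field k] {p : ℕ} (hp : 0 < p) [CharP k p]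
    {X : Type} [Group X] [Finite X] (N : Subgroup X) [N.Normal]
    {A B : Type} [AddCommGroup A] [Module k A] [FiniteDimensional k A]
    [AddCommGroup B] [Module k B] [FiniteDimensional k B]
    (ρA : Representation k (X ⧸ N) A) (ρB : Representation k (X ⧸ N) B) :
    (ExtOneZero (ρA.comp (QuotientGroup.mk' N)) (ρB.comp (QuotientGroup.mk' N)) →
        ExtOneZero ρA ρB) ∧
      (ExtOneZero ρA ρB →
        (∀ M : Subgroup N, M.Normal →
            (∃ e : ℕ, Nat.card N = p ^ e * Nat.card M) → M = ⊤) →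
        ExtOneZero (ρA.comp (QuotientGroup.mk' N)) (ρB.comp (QuotientGroup.mk' N))) := by
  have hprime : p.Prime := (CharP.char_is_prime_or_zero k p).resolve_right hp.ne'
  have : Fact p.Prime := ⟨hprime⟩
  refine ⟨fun h => h.of_comp_surjective (QuotientGroup.mk'_surjective N), ?_⟩
  intro h hN E _ _ σ ι π hι hπ hex hιeq hπeq
  have htriv : ∀ n ∈ N, σ n = 1 := by
    let τ : Representation k N E := σ.comp N.subtype
    have hpow : ∀ n : N, τ (n ^ p) = 1 := by
      intro n
      have hA : π ∘ₗ τ n = π := by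
        have hn := hπeq n
        rw [MonoidHom.comp_apply, QuotientGroup.mk'_apply,
          (QuotientGroup.eq_one_iff (n : X)).2 n.2, map_one] at hn
        exact hn
      have hB : τ n ∘ₗ ι = ι := by
        have hn := hιeq n
        rw [MonoidHom.comp_apply, QuotientGroup.mk'_apply,
          (QuotientGroup.eq_one_iff (n : X)).2 n.2, map_one] at hn
        exact hn.symm
      rw [map_pow]
      exact pow_char_eq_one_of_trivial_on_sub_quotient p ι π hex.le hB hA
    have hpg : IsPGroup p (N ⧸ τ.ker) := by
      intro q
      induction q using QuotientGroup.induction_on with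
      | H n =>
        refine ⟨1, ?_⟩
        rw [pow_one, ← QuotientGroup.mk_pow, QuotientGroup.eq_one_iff]
        exact hpow n
    obtain ⟨e, he⟩ := IsPGroup.iff_card.1 hpg
    have htop := hN τ.ker inferInstance
      ⟨e, by rw [← he, ← Subgroup.card_eq_card_quotient_mul_card_subgroup]⟩
    intro n hn
    have hmem : (⟨n, hn⟩ : N) ∈ τ.ker := htop ▸ Subgroup.mem_top _
    exact hmem
  obtain ⟨s, hs, hπs⟩ := h E (QuotientGroup.lift N σ htriv) ι π hι hπ hex
    (fun q => by
      induction q using QuotientGroup.induction_on with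
      | H g => exact hιeq g)
    (fun q => by
      induction q using QuotientGroup.induction_on with
      | H g => exact hπeq g)
  exact ⟨s, fun g => hs g, hπs⟩
end

section
/- Let k be an algebraically closed field of characteristic p > 0 and let the finite group H be a central product of quasisimple subgroups H₁, …, H_n (that is, H is generated by the H_i, and [H_i, H_j] = 1 whenever i ≠ j), where each center Z(H_i) has order coprime to p. For i = 1, 2, let W_i be a nontrivial finite-dimensional irreducible kH-module such that the image of H in GL(W_i) is a quasisimple group. Suppose the kernels of the actions of H on W₁ and on W₂ are different subgroups of H. Then every short exact sequence of kH-modules 0 → W₂ → E → W₁ → 0 splits (i.e. Ext¹_H(W₁, W₂) = 0). -/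
universe u v w

/-- A group is quasisimple if it is perfect and its central quotient is a nonabelian
simple group. -/
def IsQuasisimple (L : Type*) [Group L] : Prop :=
  commutator L = ⊤ ∧ IsSimpleGroup (L ⧸ Subgroup.center L) ∧
    ∃ a b : L ⧸ Subgroup.center L, a * b ≠ b * a

/-- `H` is the central product of the family of subgroups `L i`: the `L i` generate `H`
and elements of distinct factors commute. -/
def IsCentralProductOf {G : Type*} [Group G] (H : Subgroup G) {ι : Type*}
    (L : ι → Subgroup G) : Prop :=
  (∀ i, L i ≤ H) ∧ (⨆ i, L i) = H ∧
    ∀ i j, i ≠ j → ∀ x ∈ L i, ∀ y ∈ L j, x * y = y * x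

section Splitting

variable {k G E A B : Type*} [Field k] [Group G] [AddCommGroup E] [Module k E]
  [AddCommGroup A] [Module k A] [AddCommGroup B] [Module k B]
  {ρA : Representation k G A} {ρB : Representation k G B} {σ : Representation k G E}
  {ι : B →ₗ[k] E} {π : E →ₗ[k] A}

/-- An invariant complement of the kernel of an equivariant surjection gives an equivariant
section. -/
theorem exists_equivariant_section_of_complement
    (hπσ : ∀ g : G, π ∘ₗ σ g = ρA g ∘ₗ π) (U : Submodule k E)
    (hU : ∀ g, ∀ u ∈ U, σ g u ∈ U) (hdisj : ∀ u ∈ U, π u = 0 → u = 0)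
    (hsurj : ∀ a, ∃ u ∈ U, π u = a) :
    ∃ s : A →ₗ[k] E, (∀ g : G, s ∘ₗ ρA g = σ g ∘ₗ s) ∧ π ∘ₗ s = LinearMap.id := by
  have hinj : ∀ u ∈ U, ∀ v ∈ U, π u = π v → u = v := fun u hu v hv h =>
    sub_eq_zero.1 (hdisj _ (U.sub_mem hu hv) (by rw [map_sub, h, sub_self]))
  choose s hsU hs using hsurj
  refine ⟨{ toFun := s, map_add' := ?_, map_smul' := ?_ }, ?_, ?_⟩
  · intro a b
    exact hinj _ (hsU _) _ (U.add_mem (hsU _) (hsU _)) (by simp [hs])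
  · intro c a
    exact hinj _ (hsU _) _ (U.smul_mem _ (hsU _)) (by simp [hs])
  · intro g
    ext a
    refine hinj _ (hsU _) _ (hU g _ (hsU _)) ?_
    have := LinearMap.congr_fun (hπσ g) (s a)
    simp only [LinearMap.comp_apply] at this
    simp [this, hs]
  · ext a
    exact hs a

/-- The fixed points of a normal subgroup acting nontrivially on an irreducible module vanish. -/
theorem eq_zero_of_fixed_by_normal (hirr : Irred ρA) (N : Subgroup G) [hN : N.Normal]
    (hnt : ¬ N ≤ ρA.ker) {a : A} (ha : ∀ g ∈ N, ρA g a = a) : a = 0 := by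
  let F : Submodule k A :=
    { carrier := {a | ∀ g ∈ N, ρA g a = a}
      add_mem' := fun hx hy g hg => by rw [map_add, hx g hg, hy g hg]
      zero_mem' := fun g _ => map_zero _
      smul_mem' := fun c x hx g hg => by rw [map_smul, hx g hg] }
  have hF : IsInvt ρA ⊤ F := by
    intro h _ x hx g hg
    have := hx _ (hN.conj_mem g hg h⁻¹)
    calc ρA g (ρA h x) = ρA h (ρA (h⁻¹ * g * h⁻¹⁻¹) x) := by
          simp only [← Module.End.mul_apply, ← map_mul]; congr 2; group
      _ = _ := by rw [this]
  rcases hirr.2.2 F le_top hF with h | h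
  · have : a ∈ F := ha
    simpa [h] using this
  · refine absurd (fun g hg => ?_) hnt
    rw [MonoidHom.mem_ker]
    ext x
    have : x ∈ F := h ▸ Submodule.mem_top
    exact this g hg

/-- The vectors `g a - a`, for `g` in a normal subgroup acting nontrivially on an irreducible
module, span it. -/
theorem span_sub_eq_top_of_normal (hirr : Irred ρA) (N : Subgroup G) [hN : N.Normal]
    (hnt : ¬ N ≤ ρA.ker) :
    Submodule.span k {x | ∃ g ∈ N, ∃ a, ρA g a - a = x} = ⊤ := by
  refine (hirr.2.2 _ le_top ?_).resolve_left ?_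
  · intro h _ x hx
    induction hx using Submodule.span_induction with
    | mem x hx =>
      obtain ⟨g, hg, a, rfl⟩ := hx
      refine Submodule.subset_span ⟨h * g * h⁻¹, hN.conj_mem g hg h, ρA h a, ?_⟩
      simp only [map_sub, ← Module.End.mul_apply, ← map_mul]
      congr 3; group
    | zero => simp
    | add x y _ _ hx hy => rw [map_add]; exact Submodule.add_mem _ hx hy
    | smul c x _ hx => rw [map_smul]; exact Submodule.smul_mem _ _ hx
  · intro h
    refine hnt fun g hg => ?_
    rw [MonoidHom.mem_ker]
    ext a
    have : ρA g a - a ∈ Submodule.span k {x | ∃ g ∈ N, ∃ a, ρA g a - a = x} :=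
      Submodule.subset_span ⟨g, hg, a, rfl⟩
    rw [h, Submodule.mem_bot] at this
    exact sub_eq_zero.1 this

/-- Extensions split when commuting normal subgroups act nontrivially on one end each and
trivially on the other. -/
theorem exists_equivariant_section_of_commuting_normal
    (hker : LinearMap.ker π = LinearMap.range ι) (hι : Function.Injective ι)
    (hισ : ∀ g : G, ι ∘ₗ ρB g = σ g ∘ₗ ι) (hπσ : ∀ g : G, π ∘ₗ σ g = ρA g ∘ₗ π)
    (hπ : Function.Surjective π)
    (hirrA : Irred ρA) (hirrB : Irred ρB) (N M : Subgroup G) [hN : N.Normal] [M.Normal]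
    (hcomm : ∀ x ∈ N, ∀ y ∈ M, x * y = y * x)
    (hNA : ¬ N ≤ ρA.ker) (hNB : N ≤ ρB.ker) (hMA : M ≤ ρA.ker) (hMB : ¬ M ≤ ρB.ker) :
    ∃ s : A →ₗ[k] E, (∀ g : G, s ∘ₗ ρA g = σ g ∘ₗ s) ∧ π ∘ₗ s = LinearMap.id := by
  have hισ' : ∀ g b, σ g (ι b) = ι (ρB g b) := fun g b => (LinearMap.congr_fun (hισ g) b).symm
  have hπσ' : ∀ g e, π (σ g e) = ρA g (π e) := fun g => LinearMap.congr_fun (hπσ g)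
  have hmem : ∀ e, π e = 0 → ∃ b, ι b = e := fun e he => by
    have : e ∈ LinearMap.ker π := he
    rwa [hker] at this
  let U := Submodule.span k {x | ∃ g ∈ N, ∃ e, σ g e - e = x}
  have hfix : ∀ u ∈ U, ∀ y ∈ M, σ y u = u := by
    intro u hu y hy
    induction hu using Submodule.span_induction with
    | mem u hu =>
      obtain ⟨g, hg, e, rfl⟩ := hu
      obtain ⟨b, hb⟩ := hmem (σ y e - e) (by
        rw [map_sub, hπσ', MonoidHom.mem_ker.1 (hMA hy)]; simp)
      have h : σ g (σ y e - e) = σ y e - e := by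
        rw [← hb, hισ', MonoidHom.mem_ker.1 (hNB hg)]; simp
      have hc : σ y (σ g e) = σ g (σ y e) := by
        simp only [← Module.End.mul_apply, ← map_mul, hcomm g hg y hy]
      rw [map_sub] at h
      rw [map_sub, hc, sub_eq_sub_iff_sub_eq_sub, h]
    | zero => simp
    | add u v _ _ hu hv => rw [map_add, hu, hv]
    | smul c u _ hu => rw [map_smul, hu]
  refine exists_equivariant_section_of_complement hπσ U ?_ ?_ ?_
  · intro h x hx
    induction hx using Submodule.span_induction with
    | mem x hx =>
      obtain ⟨g, hg, e, rfl⟩ := hx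
      refine Submodule.subset_span ⟨h * g * h⁻¹, hN.conj_mem g hg h, σ h e, ?_⟩
      simp only [map_sub, ← Module.End.mul_apply, ← map_mul]
      congr 3; group
    | zero => simp
    | add x y _ _ hx hy => rw [map_add]; exact Submodule.add_mem _ hx hy
    | smul c x _ hx => rw [map_smul]; exact Submodule.smul_mem _ _ hx
  · intro u hu h0
    obtain ⟨b, rfl⟩ := hmem u h0
    rw [eq_zero_of_fixed_by_normal hirrB M hMB (a := b), map_zero]
    intro y hy
    exact hι (by rw [← hισ', hfix _ hu y hy])
  · intro a
    have ha : a ∈ Submodule.span k {x | ∃ g ∈ N, ∃ a, ρA g a - a = x} := by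
      rw [span_sub_eq_top_of_normal hirrA N hNA]; trivial
    suffices a ∈ U.map π from this
    refine Submodule.span_le.2 ?_ ha
    rintro _ ⟨g, hg, a, rfl⟩
    obtain ⟨e, rfl⟩ := hπ a
    exact ⟨_, Submodule.subset_span ⟨g, hg, e, rfl⟩, by rw [map_sub, hπσ']⟩

/-- A central element acting nontrivially on an irreducible module has no nonzero fixed
vectors. -/
theorem eq_zero_of_fixed_by_central (hirr : Irred ρA) {z : G} (hz : ∀ g, g * z = z * g)
    (hnt : z ∉ ρA.ker) {a : A} (ha : ρA z a = a) : a = 0 := by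
  have hcomm : ∀ g x, ρA z (ρA g x) = ρA g (ρA z x) := fun g x => by
    simp only [← Module.End.mul_apply, ← map_mul, hz g]
  rcases hirr.2.2 (LinearMap.ker (ρA z - 1)) le_top (fun g _ x hx => by
    have hx : ρA z x - x = 0 := hx
    change ρA z (ρA g x) - ρA g x = 0
    rw [hcomm, sub_eq_zero.1 hx, sub_self]) with h | h
  · have : a ∈ LinearMap.ker (ρA z - 1) := sub_eq_zero.2 ha
    simpa [h] using this
  · exact absurd (sub_eq_zero.1 (LinearMap.ker_eq_top.1 h)) hnt

/-- If a central element acts nontrivially on an irreducible module, every vector has the form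
`z a - a`. -/
theorem exists_sub_eq_of_central (hirr : Irred ρA) {z : G} (hz : ∀ g, g * z = z * g)
    (hnt : z ∉ ρA.ker) (x : A) : ∃ a, ρA z a - a = x := by
  have hcomm : ∀ g x, ρA z (ρA g x) = ρA g (ρA z x) := fun g x => by
    simp only [← Module.End.mul_apply, ← map_mul, hz g]
  rcases hirr.2.2 (LinearMap.range (ρA z - 1)) le_top (by
    rintro g _ _ ⟨x, rfl⟩
    refine ⟨ρA g x, ?_⟩
    change ρA z (ρA g x) - ρA g x = ρA g (ρA z x - x)
    rw [hcomm, map_sub]) with h | h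
  · exact absurd (sub_eq_zero.1 (LinearMap.range_eq_bot.1 h)) hnt
  · exact LinearMap.range_eq_top.1 h x

/-- Extensions split when a central element acts trivially on exactly one of the ends. -/
theorem exists_equivariant_section_of_central
    (hker : LinearMap.ker π = LinearMap.range ι) (hι : Function.Injective ι)
    (hισ : ∀ g : G, ι ∘ₗ ρB g = σ g ∘ₗ ι) (hπσ : ∀ g : G, π ∘ₗ σ g = ρA g ∘ₗ π)
    (hπ : Function.Surjective π)
    (hirrA : Irred ρA) (hirrB : Irred ρB) {z : G} (hz : ∀ g, g * z = z * g)
    (h : z ∈ ρA.ker ∧ z ∉ ρB.ker ∨ z ∈ ρB.ker ∧ z ∉ ρA.ker) :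
    ∃ s : A →ₗ[k] E, (∀ g : G, s ∘ₗ ρA g = σ g ∘ₗ s) ∧ π ∘ₗ s = LinearMap.id := by
  have hισ' : ∀ g b, σ g (ι b) = ι (ρB g b) := fun g b => (LinearMap.congr_fun (hισ g) b).symm
  have hπσ' : ∀ g e, π (σ g e) = ρA g (π e) := fun g => LinearMap.congr_fun (hπσ g)
  have hmem : ∀ e, π e = 0 → ∃ b, ι b = e := fun e he => by
    have : e ∈ LinearMap.ker π := he
    rwa [hker] at this
  have hπι : ∀ b, π (ι b) = 0 := fun b => by
    have : ι b ∈ LinearMap.ker π := hker ▸ LinearMap.mem_range_self ι b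
    exact this
  have hcomm : ∀ g x, σ z (σ g x) = σ g (σ z x) := fun g x => by
    simp only [← Module.End.mul_apply, ← map_mul, hz g]
  rcases h with ⟨hA, hB⟩ | ⟨hB, hA⟩
  · refine exists_equivariant_section_of_complement hπσ (LinearMap.ker (σ z - 1)) ?_ ?_ ?_
    · intro g u hu
      have hu : σ z u - u = 0 := hu
      change σ z (σ g u) - σ g u = 0
      rw [hcomm, sub_eq_zero.1 hu, sub_self]
    · intro u hu h0
      have hu : σ z u - u = 0 := hu
      obtain ⟨b, rfl⟩ := hmem u h0
      rw [eq_zero_of_fixed_by_central hirrB hz hB (a := b), map_zero]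
      exact hι (by rw [← hισ', sub_eq_zero.1 hu])
    · intro a
      obtain ⟨e, rfl⟩ := hπ a
      obtain ⟨b, hb⟩ := hmem (σ z e - e) (by
        rw [map_sub, hπσ', MonoidHom.mem_ker.1 hA]; simp)
      obtain ⟨c, rfl⟩ := exists_sub_eq_of_central hirrB hz hB b
      refine ⟨e - ι c, ?_, by rw [map_sub, hπι, sub_zero]⟩
      change σ z (e - ι c) - (e - ι c) = 0
      rw [map_sub, hισ', sub_sub_sub_comm, ← hb, map_sub, sub_self]
  · refine exists_equivariant_section_of_complement hπσ (LinearMap.range (σ z - 1)) ?_ ?_ ?_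
    · rintro g _ ⟨x, rfl⟩
      refine ⟨σ g x, ?_⟩
      change σ z (σ g x) - σ g x = σ g (σ z x - x)
      rw [hcomm, map_sub]
    · rintro _ ⟨e, rfl⟩ h0
      have h0 : π (σ z e - e) = 0 := h0
      change σ z e - e = 0
      rw [map_sub, hπσ', sub_eq_zero] at h0
      obtain ⟨b, rfl⟩ := hmem e (eq_zero_of_fixed_by_central hirrA hz hA h0)
      rw [hισ', MonoidHom.mem_ker.1 hB]
      simp
    · intro a
      obtain ⟨c, rfl⟩ := exists_sub_eq_of_central hirrA hz hA a
      obtain ⟨e, rfl⟩ := hπ c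
      refine ⟨_, ⟨e, rfl⟩, ?_⟩
      change π (σ z e - e) = _
      rw [map_sub, hπσ']

end Splitting

section Quasisimple

open scoped commutatorElement

variable {G : Type*} [Group G]

/-- A noncentral normal subgroup of a group with simple central quotient generates the group
together with the center. -/
theorem sup_center_eq_top_of_not_le_center (hs : IsSimpleGroup (G ⧸ Subgroup.center G))
    (N : Subgroup G) [hN : N.Normal] (h : ¬ N ≤ Subgroup.center G) :
    N ⊔ Subgroup.center G = ⊤ := by
  have hn : (N.map (QuotientGroup.mk' (Subgroup.center G))).Normal :=
    hN.map _ (QuotientGroup.mk'_surjective _)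
  rcases hs.eq_bot_or_eq_top_of_normal _ hn with h' | h'
  · rw [Subgroup.map_eq_bot_iff, QuotientGroup.ker_mk'] at h'
    exact absurd h' h
  · have := congrArg (Subgroup.comap (QuotientGroup.mk' (Subgroup.center G))) h'
    rwa [Subgroup.comap_map_eq, QuotientGroup.ker_mk', Subgroup.comap_top] at this

/-- Proper normal subgroups of a quasisimple group are central. -/
theorem IsQuasisimple.le_center_of_normal (hG : IsQuasisimple G) (N : Subgroup G) [hN : N.Normal]
    (h : N ≠ ⊤) : N ≤ Subgroup.center G := by
  by_contra hc
  have htop := sup_center_eq_top_of_not_le_center hG.2.1 N hc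
  refine h (top_le_iff.1 ?_)
  rw [← hG.1, commutator_def, Subgroup.commutator_le]
  intro x _ y _
  have hx : x ∈ N ⊔ Subgroup.center G := htop ▸ Subgroup.mem_top x
  obtain ⟨n, hn, z, hz, rfl⟩ := Subgroup.mem_sup_of_normal_left.1 hx
  have hzy : z * y = y * z := (Subgroup.mem_center_iff.1 hz y).symm
  have : ⁅n * z, y⁆ = n * (y * n⁻¹ * y⁻¹) := by
    rw [commutatorElement_def, mul_assoc n z y, hzy]; group
  rw [this]
  exact N.mul_mem hn (hN.conj_mem _ (N.inv_mem hn) y)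

variable {ι : Type*} {L : ι → Subgroup G}

/-- The factors of a central product are normal. -/
theorem IsCentralProductOf.normal (hL : IsCentralProductOf (⊤ : Subgroup G) L) (i : ι) :
    (L i).Normal := by
  rw [← Subgroup.normalizer_eq_top_iff, ← top_le_iff, ← hL.2.1, iSup_le_iff]
  intro j
  by_cases hij : j = i
  · subst hij
    exact Subgroup.le_normalizer
  · intro y hy
    have hconj : ∀ x ∈ L i, y * x * y⁻¹ = x := fun x hx => by
      rw [hL.2.2 j i hij y hy x hx, mul_inv_cancel_right]
    rw [Subgroup.mem_normalizer_iff]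
    refine fun x => ⟨fun hx => by rwa [hconj x hx], fun hx => ?_⟩
    have := hconj _ hx
    rw [mul_left_inj, mul_right_inj] at this
    rwa [this] at hx

/-- A quasisimple quotient of a central product of perfect groups is the image of a single factor:
the other factors are in the kernel. -/
theorem IsCentralProductOf.exists_factor (hL : IsCentralProductOf (⊤ : Subgroup G) L)
    (hperf : ∀ i, commutator (L i) = ⊤) (K : Subgroup G) [K.Normal] (hK : IsQuasisimple (G ⧸ K)) :
    ∃ a, ¬ L a ≤ K ∧ ∀ j, j ≠ a → L j ≤ K := by
  let q := QuotientGroup.mk' K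
  have hq : Function.Surjective q := QuotientGroup.mk'_surjective K
  obtain ⟨a, ha⟩ : ∃ a, ¬ (L a).map q ≤ Subgroup.center (G ⧸ K) := by
    by_contra! hall
    have htop : Subgroup.center (G ⧸ K) = ⊤ := by
      rw [← top_le_iff, ← Subgroup.map_top_of_surjective q hq, ← hL.2.1, Subgroup.map_iSup]
      exact iSup_le hall
    obtain ⟨x, y, hxy⟩ := hK.2.2
    have : Subsingleton ((G ⧸ K) ⧸ Subgroup.center (G ⧸ K)) :=
      QuotientGroup.subsingleton_iff.2 htop
    exact hxy (Subsingleton.elim _ _)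
  have hna : ((L a).map q).Normal := (hL.normal a).map q hq
  have hsup := sup_center_eq_top_of_not_le_center hK.2.1 ((L a).map q) ha
  refine ⟨a, fun h => ha ?_, fun j hj => ?_⟩
  · rw [(Subgroup.map_eq_bot_iff _).2 (by rwa [QuotientGroup.ker_mk'])]
    exact bot_le
  have hcent : (L j).map q ≤ Subgroup.center (G ⧸ K) := by
    rintro _ ⟨y, hy, rfl⟩
    rw [Subgroup.mem_center_iff]
    intro t
    have ht : t ∈ (L a).map q ⊔ Subgroup.center (G ⧸ K) := hsup ▸ Subgroup.mem_top t
    obtain ⟨_, ⟨x, hx, rfl⟩, z, hz, rfl⟩ := Subgroup.mem_sup_of_normal_left.1 ht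
    rw [mul_assoc, ← Subgroup.mem_center_iff.1 hz, ← mul_assoc, ← mul_assoc, ← map_mul, ← map_mul,
      hL.2.2 j a hj y hy x hx]
  have hcomm : ⁅L j, L j⁆ = L j := by
    have := congrArg (Subgroup.map (L j).subtype) (hperf j)
    rwa [commutator_def, Subgroup.map_commutator, ← MonoidHom.range_eq_map,
      Subgroup.range_subtype] at this
  rw [← hcomm, Subgroup.commutator_le]
  intro x hx y hy
  have hxy := Subgroup.mem_center_iff.1 (hcent ⟨y, hy, rfl⟩) (q x)
  rw [← QuotientGroup.ker_mk' K, MonoidHom.mem_ker]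
  change q ⁅x, y⁆ = 1
  rw [map_commutatorElement, commutatorElement_eq_one_iff_mul_comm]
  exact hxy

/-- If `K₁ ⊄ K₂` both contain all factors but the quasisimple factor `L a`, which is not contained
in `K₁`, then some central element lies in `K₁` and not in `K₂`. -/
theorem IsCentralProductOf.exists_central_mem_not_mem
    (hL : IsCentralProductOf (⊤ : Subgroup G) L) {a : ι} (ha : IsQuasisimple (L a))
    {K₁ K₂ : Subgroup G} [hK₁ : K₁.Normal] (h₁ : ∀ j, j ≠ a → L j ≤ K₁)
    (h₂ : ∀ j, j ≠ a → L j ≤ K₂) (haK : ¬ L a ≤ K₁) (hne : ¬ K₁ ≤ K₂) :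
    ∃ z, (∀ g, g * z = z * g) ∧ z ∈ K₁ ∧ z ∉ K₂ := by
  have hnormal := hL.normal a
  obtain ⟨x, hx₁, hx₂⟩ := SetLike.not_le_iff_exists.1 hne
  have hx : x ∈ L a ⊔ (K₁ ⊓ K₂) := by
    suffices ⊤ ≤ L a ⊔ (K₁ ⊓ K₂) from this trivial
    rw [← hL.2.1, iSup_le_iff]
    intro j
    by_cases hj : j = a
    · exact hj ▸ le_sup_left
    · exact (le_inf (h₁ j hj) (h₂ j hj)).trans le_sup_right
  obtain ⟨z, hz, y, hy, rfl⟩ := Subgroup.mem_sup_of_normal_left.1 hx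
  have hz₁ : z ∈ K₁ := (Subgroup.mul_mem_cancel_right _ hy.1).1 hx₁
  have hz₂ : z ∉ K₂ := fun h => hx₂ (K₂.mul_mem h hy.2)
  have hcen := ha.le_center_of_normal (K₁.subgroupOf (L a))
    (fun h => haK (Subgroup.subgroupOf_eq_top.1 h))
  have hzc := Subgroup.mem_center_iff.1 (hcen (x := ⟨z, hz⟩) (Subgroup.mem_subgroupOf.2 hz₁))
  refine ⟨z, fun g => ?_, hz₁, hz₂⟩
  suffices ⊤ ≤ Subgroup.centralizer {z} from
    (Subgroup.mem_centralizer_singleton_iff.1 (this (Subgroup.mem_top g)))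
  rw [← hL.2.1, iSup_le_iff]
  intro j g hg
  rw [Subgroup.mem_centralizer_singleton_iff]
  by_cases hj : j = a
  · subst hj
    exact congrArg Subtype.val (hzc ⟨g, hg⟩)
  · exact hL.2.2 j a hj g hg z hz

end Quasisimple

/-- Let `k` be an algebraically closed field of characteristic `p > 0`
and let the finite group `H` be a central product of quasisimple subgroups `H₁, …, Hₙ`
whose centers have order coprime to `p`.  Let `W₁`, `W₂` be nontrivial finite-dimensional
irreducible `kH`-modules on which `H` acts with quasisimple image, and with different
kernels.  Then `Ext¹_H(W₁, W₂) = 0`. -/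
theorem statement_15 {k : Type} [Field k] [IsAlgClosed k] {p : ℕ} (hp : 0 < p) [CharP k p]
    {H : Type} [Group H] [Finite H] {n : ℕ} (Hs : Fin n → Subgroup H)
    (hcp : IsCentralProductOf (⊤ : Subgroup H) Hs)
    (hqs : ∀ i, IsQuasisimple (Hs i))
    (hz : ∀ i, Nat.Coprime (Nat.card (Subgroup.center (Hs i))) p)
    {W₁ W₂ : Type} [AddCommGroup W₁] [Module k W₁] [FiniteDimensional k W₁]
    [AddCommGroup W₂] [Module k W₂] [FiniteDimensional k W₂]
    (ρ₁ : Representation k H W₁) (ρ₂ : Representation k H W₂)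
    (hirr₁ : Irred ρ₁) (hirr₂ : Irred ρ₂)
    (hnt₁ : ∃ (g : H) (w : W₁), ρ₁ g w ≠ w) (hnt₂ : ∃ (g : H) (w : W₂), ρ₂ g w ≠ w)
    (himg₁ : IsQuasisimple (H ⧸ MonoidHom.ker ρ₁))
    (himg₂ : IsQuasisimple (H ⧸ MonoidHom.ker ρ₂))
    (hker : MonoidHom.ker ρ₁ ≠ MonoidHom.ker ρ₂) :
    ExtOneZero ρ₁ ρ₂ := by
  obtain ⟨a, ha, ha'⟩ := hcp.exists_factor (fun i => (hqs i).1) _ himg₁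
  obtain ⟨b, hb, hb'⟩ := hcp.exists_factor (fun i => (hqs i).1) _ himg₂
  intro E _ _ σ ι π hι hπ hexact hισ hπσ
  by_cases hab : a = b
  · subst hab
    obtain ⟨z, hz, h⟩ : ∃ z, (∀ g, g * z = z * g) ∧
        (z ∈ ρ₁.ker ∧ z ∉ ρ₂.ker ∨ z ∈ ρ₂.ker ∧ z ∉ ρ₁.ker) := by
      by_cases hle : ρ₁.ker ≤ ρ₂.ker
      · obtain ⟨z, hz, h⟩ := hcp.exists_central_mem_not_mem (hqs a) hb' ha' hb
          (fun h => hker (le_antisymm hle h))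
        exact ⟨z, hz, Or.inr h⟩
      · obtain ⟨z, hz, h⟩ := hcp.exists_central_mem_not_mem (hqs a) ha' hb' ha hle
        exact ⟨z, hz, Or.inl h⟩
    exact exists_equivariant_section_of_central hexact hι hισ hπσ hπ hirr₁ hirr₂ hz h
  · have := hcp.normal a
    have := hcp.normal b
    exact exists_equivariant_section_of_commuting_normal hexact hι hισ hπσ hπ hirr₁ hirr₂
      (Hs a) (Hs b) (hcp.2.2 a b hab) ha (hb' a hab) (ha' b (Ne.symm hab)) hb
end

section
/- Let k be an algebraically closed field of characteristic p > 0, G a finite group, and V a finite-dimensional indecomposable kG-module. Suppose a normal subgroup N of G of order coprime to p acts by scalar transformations on some composition factor L of V. Then N acts by scalar transformations on all of V. If in addition V is a faithful kG-module, then N is contained in the center Z(G) of G. -/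
section CharacterProjector

variable {k G V : Type*} [Field k] [Group G] [AddCommGroup V] [Module k V]

theorem map_mul_map_inv_eq_one {N : Subgroup G} (χ : N →* k) (x : N) : χ x * χ x⁻¹ = 1 := by
  rw [← map_mul, mul_inv_cancel, map_one]

/-- The averaging operator `|N|⁻¹ ∑ χ(x)⁻¹ ρ(x)` attached to a linear character `χ` of `N`. -/
noncomputable def characterProjector (ρ : Representation k G V) (N : Subgroup G) [Fintype N]
    (χ : N →* k) : Module.End k V :=
  (Fintype.card N : k)⁻¹ • ∑ x : N, χ x⁻¹ • ρ x

variable {ρ : Representation k G V} {N : Subgroup G} [Fintype N] {χ : N →* k}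

theorem rho_mul_characterProjector (y : N) :
    ρ y * characterProjector ρ N χ = χ y • characterProjector ρ N χ := by
  rw [characterProjector, mul_smul_comm, smul_comm, Finset.mul_sum, Finset.smul_sum (r := χ y)]
  refine congrArg _ (Fintype.sum_equiv (Equiv.mulLeft y) _ _ fun x => ?_)
  rw [Equiv.coe_mulLeft, mul_smul_comm, ← map_mul ρ, smul_smul, mul_inv_rev, map_mul χ,
    mul_left_comm, map_mul_map_inv_eq_one, mul_one]
  rfl

theorem isIdempotentElem_characterProjector (hcard : (Fintype.card N : k) ≠ 0) :
    IsIdempotentElem (characterProjector ρ N χ) := by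
  change characterProjector ρ N χ * characterProjector ρ N χ = _
  conv_lhs => enter [1]; rw [characterProjector]
  simp_rw [smul_mul_assoc, Finset.sum_mul, smul_mul_assoc, rho_mul_characterProjector, smul_smul,
    mul_comm (χ _⁻¹), map_mul_map_inv_eq_one, one_smul, Finset.sum_const, Finset.card_univ,
    ← Nat.cast_smul_eq_nsmul k, smul_smul, inv_mul_cancel₀ hcard, one_smul]

theorem rho_mul_characterProjector_comm [N.Normal]
    (hχ : ∀ (g : G) (x : N), χ (MulAut.conjNormal g x) = χ x) (g : G) :
    ρ g * characterProjector ρ N χ = characterProjector ρ N χ * ρ g := by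
  rw [characterProjector, mul_smul_comm, smul_mul_assoc, Finset.mul_sum, Finset.sum_mul]
  congr 1
  refine Fintype.sum_equiv (MulAut.conjNormal g).toEquiv _ _ fun x => ?_
  rw [MulEquiv.toEquiv_eq_coe, MulEquiv.coe_toEquiv, ← map_inv, hχ, mul_smul_comm,
    smul_mul_assoc, ← map_mul, ← map_mul, MulAut.conjNormal_apply, inv_mul_cancel_right]

theorem characterProjector_apply_sub_mem (hcard : (Fintype.card N : k) ≠ 0) {A : Submodule k V}
    {v : V} (hv : ∀ x : N, ρ x v - χ x • v ∈ A) : characterProjector ρ N χ v - v ∈ A := by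
  have key : characterProjector ρ N χ v - v =
      (Fintype.card N : k)⁻¹ • ∑ x : N, χ x⁻¹ • (ρ x v - χ x • v) := by
    simp_rw [smul_sub, smul_smul, mul_comm (χ _⁻¹), map_mul_map_inv_eq_one, one_smul,
      Finset.sum_sub_distrib, Finset.sum_const, Finset.card_univ, ← Nat.cast_smul_eq_nsmul k,
      smul_sub, smul_smul, inv_mul_cancel₀ hcard, one_smul]
    simp [characterProjector]
  rw [key]
  exact A.smul_mem _ (A.sum_mem fun x _ => A.smul_mem _ (hv x))

end CharacterProjector

section ScalarsModulo

variable {k G V : Type*} [Field k] [Group G] [AddCommGroup V] [Module k V]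

theorem eq_of_sub_smul_mem {A : Submodule k V} {b w : V} (hb : b ∉ A) {c d : k}
    (hc : w - c • b ∈ A) (hd : w - d • b ∈ A) : c = d := by
  by_contra hcd
  have h : (d - c) • b ∈ A := by
    convert A.sub_mem hc hd using 1
    module
  exact hb ((A.smul_mem_iff (sub_ne_zero.2 (Ne.symm hcd))).1 h)

/-- If `N` acts by scalars on the nonzero quotient `B/A`, then it does so through a linear
character that is invariant under conjugation by `G`. -/
theorem exists_character_of_scalar {ρ : Representation k G V} {N : Subgroup G} [N.Normal]
    {A B : Submodule k V} (hA : IsInvt ρ ⊤ A) (hB : IsInvt ρ ⊤ B) (hBA : ¬ B ≤ A)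
    (hscalar : ∀ x ∈ N, ∃ c : k, ∀ v ∈ B, ρ x v - c • v ∈ A) :
    ∃ χ : N →* k, (∀ x : N, ∀ v ∈ B, ρ x v - χ x • v ∈ A) ∧
      ∀ (g : G) (x : N), χ (MulAut.conjNormal g x) = χ x := by
  obtain ⟨b, hbB, hbA⟩ := SetLike.not_le_iff_exists.1 hBA
  choose c hc using fun x : N => hscalar x x.2
  refine ⟨⟨⟨c, ?_⟩, fun x y => ?_⟩, hc, fun g x => ?_⟩
  · exact eq_of_sub_smul_mem hbA (hc 1 b hbB) (by simp)
  · refine eq_of_sub_smul_mem hbA (hc (x * y) b hbB) ?_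
    convert A.add_mem (hc x _ (hB y trivial b hbB)) (A.smul_mem (c x) (hc y b hbB)) using 1
    rw [Subgroup.coe_mul, map_mul, Module.End.mul_apply]
    module
  · refine eq_of_sub_smul_mem hbA (hc (MulAut.conjNormal g x) b hbB) ?_
    convert hA g trivial _ (hc x _ (hB g⁻¹ trivial b hbB)) using 1
    simp [MulAut.conjNormal_apply]

theorem mem_center_of_rho_eq_smul_id {ρ : Representation k G V} (hρ : Function.Injective ρ)
    {x : G} {c : k} (hx : ρ x = c • (LinearMap.id : V →ₗ[k] V)) : x ∈ Subgroup.center G := by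
  refine Subgroup.mem_center_iff.2 fun g => hρ ?_
  rw [map_mul, map_mul, hx]
  ext v
  simp

end ScalarsModulo

/-- Let `k` be an algebraically closed field of characteristic `p > 0`,
`G` a finite group and `V` a finite-dimensional indecomposable `kG`-module.  If a normal
subgroup `N` of `G` of order coprime to `p` acts by scalars on some composition factor
`L = B/A` of `V`, then `N` acts by scalars on all of `V`; if moreover `V` is faithful then
`N ≤ Z(G)`. -/
theorem statement_17 {k : Type} [Field k] [IsAlgClosed k] {p : ℕ} (hp : 0 < p) [CharP k p]
    {G : Type} [Group G] [Finite G]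
    {V : Type} [AddCommGroup V] [Module k V] [FiniteDimensional k V]
    (ρ : Representation k G V)
    (hnontriv : Nontrivial V)
    (hindec : ∀ U U' : Submodule k V,
      IsInvt ρ ⊤ U → IsInvt ρ ⊤ U' → IsCompl U U' → U = ⊥ ∨ U' = ⊥)
    (N : Subgroup G) (hN : N.Normal) (hNp : Nat.Coprime (Nat.card N) p)
    -- `L = B/A` is a composition factor of `V`:
    (A B : Submodule k V) (hAB : A ≤ B) (hA : IsInvt ρ ⊤ A) (hB : IsInvt ρ ⊤ B)
    (hne : A ≠ B)
    (hsimplefac : ∀ U : Submodule k V, IsInvt ρ ⊤ U → A ≤ U → U ≤ B → U = A ∨ U = B)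
    -- `N` acts by scalars on the composition factor `B/A`:
    (hscalar : ∀ x ∈ N, ∃ c : k, ∀ v ∈ B, ρ x v - c • v ∈ A) :
    (∀ x ∈ N, ∃ c : k, ρ x = c • (LinearMap.id : V →ₗ[k] V)) ∧
      (Function.Injective ρ → N ≤ Subgroup.center G) := by
  have := Fintype.ofFinite N
  have hcard : (Fintype.card N : k) ≠ 0 := fun h => by
    rw [CharP.cast_eq_zero_iff k p, ← Nat.card_eq_fintype_card] at h
    exact CharP.char_ne_one k p (Nat.Coprime.eq_one_of_dvd hNp.symm h)
  have hBA : ¬ B ≤ A := fun h => hne (le_antisymm hAB h)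
  obtain ⟨χ, hχ, hconj⟩ := exists_character_of_scalar hA hB hBA hscalar
  have hcomm (g : G) (v : V) :
      ρ g (characterProjector ρ N χ v) = characterProjector ρ N χ (ρ g v) :=
    LinearMap.congr_fun (rho_mul_characterProjector_comm hconj g) v
  have hidem := isIdempotentElem_characterProjector (ρ := ρ) (χ := χ) hcard
  have hrange : IsInvt ρ ⊤ (LinearMap.range (characterProjector ρ N χ)) := by
    rintro g - _ ⟨v, rfl⟩
    exact ⟨ρ g v, (hcomm g v).symm⟩
  have hker : IsInvt ρ ⊤ (LinearMap.ker (characterProjector ρ N χ)) := by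
    intro g _ v hv
    rw [LinearMap.mem_ker] at hv ⊢
    rw [← hcomm, hv, map_zero]
  have hid : characterProjector ρ N χ = 1 := by
    rcases hindec _ _ hrange hker (LinearMap.IsIdempotentElem.isCompl hidem) with h | h
    · refine absurd (fun b hb => ?_) hBA
      have hb' := characterProjector_apply_sub_mem hcard fun x => hχ x b hb
      rw [LinearMap.range_eq_bot.1 h] at hb'
      simpa using hb'
    · ext v
      exact LinearMap.ker_eq_bot.1 h (LinearMap.congr_fun hidem v)
  have hall : ∀ x ∈ N, ∃ c : k, ρ x = c • (LinearMap.id : V →ₗ[k] V) := fun x hx => by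
    refine ⟨χ ⟨x, hx⟩, ?_⟩
    have h := rho_mul_characterProjector (ρ := ρ) (χ := χ) ⟨x, hx⟩
    rwa [hid, mul_one] at h
  refine ⟨hall, fun hinj x hx => ?_⟩
  obtain ⟨c, hc⟩ := hall x hx
  exact mem_center_of_rho_eq_smul_id hinj hc
end
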